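/- arXiv:1507.04840 — 2 statements merged into one kernel-verified Lean document; each statement's English description precedes it below -/
import Mathlib

section
/- Let F be an algebraically closed field of characteristic zero and let a_1, …, a_m ∈ F(t_1, …, t_m) be rational functions satisfying the compatibility conditions D_i(a_j) = D_j(a_i) for all 1 ≤ i < j ≤ m. Then there exist a natural number L, rational functions g_0, g_1, …, g_L ∈ F(t_1, …, t_m) with g_1, …, g_L nonzero, and constants γ_1, …, γ_L ∈ F such that a_i = D_i(g_0) + Σ_{ℓ=1}^{L} γ_ℓ · D_i(g_ℓ)/g_ℓ for every i = 1, …, m. (Multivariate Christopher's theorem.) -/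
section Derivations

open TensorProduct in
/-- A derivation with values in a `B`-module extends along a formally étale map `A → B`. -/
theorem Derivation.exists_extension_of_formallyEtale {R A B M : Type*} [CommRing R] [CommRing A]
    [CommRing B] [Algebra R A] [Algebra R B] [Algebra A B] [IsScalarTower R A B]
    [Algebra.FormallyEtale A B] [AddCommGroup M] [Module R M] [Module A M] [Module B M]
    [IsScalarTower A B M] [IsScalarTower R A M] [IsScalarTower R B M] (d : Derivation R A M) :
    ∃ d' : Derivation R B M, ∀ a, d' (algebraMap A B a) = d a := by
  let e := KaehlerDifferential.tensorKaehlerEquivOfFormallyEtale R A B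
  let l : B ⊗[A] Ω[A⁄R] →ₗ[B] M := LinearMap.liftBaseChange B d.liftKaehlerDifferential
  refine ⟨(l ∘ₗ e.symm.toLinearMap).compDer (KaehlerDifferential.D R B), fun a => ?_⟩
  have h := KaehlerDifferential.tensorKaehlerEquivOfFormallyEtale_symm_D_algebraMap R A B a
  change l (e.symm _) = _
  refine (congrArg l h).trans ?_
  simp [l]

/-- Derivations on `B` agreeing on `A` are equal when `A → B` is formally unramified. -/
theorem Derivation.eq_of_formallyUnramified {A B M : Type*} [CommRing A]
    [CommRing B] [Algebra A B] [Algebra.FormallyUnramified A B] [AddCommGroup M] [Module B M]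
    (d₁ d₂ : Derivation ℤ B M)
    (h : ∀ a, d₁ (algebraMap A B a) = d₂ (algebraMap A B a)) : d₁ = d₂ := by
  let _ : Module A M := Module.compHom M (algebraMap A B)
  have : IsScalarTower A B M := IsScalarTower.of_algebraMap_smul fun _ _ => rfl
  let d : Derivation A B M := Derivation.mk'
    { toFun := fun b => d₁ b - d₂ b
      map_add' := fun x y => by rw [map_add, map_add]; abel
      map_smul' := fun a x => by
        rw [Algebra.smul_def, Derivation.leibniz, Derivation.leibniz, h, RingHom.id_apply,
          ← algebraMap_smul B a (d₁ x - d₂ x), smul_sub]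
        abel }
    (fun a b => by
      simp only [LinearMap.coe_mk, AddHom.coe_mk, Derivation.leibniz, smul_sub]
      abel)
  ext b
  have h0 : d.liftKaehlerDifferential (KaehlerDifferential.D A B b) = 0 := by
    rw [Subsingleton.elim (KaehlerDifferential.D A B b) 0, map_zero]
  rw [Derivation.liftKaehlerDifferential_comp_D] at h0
  exact sub_eq_zero.mp h0

theorem Derivation.logDeriv_mul {K : Type*} [Field K] (d : Derivation ℤ K K) {a b : K}
    (ha : a ≠ 0) (hb : b ≠ 0) : d (a * b) / (a * b) = d a / a + d b / b := by
  rw [Derivation.leibniz, smul_eq_mul, smul_eq_mul]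
  field_simp
  ring

theorem Derivation.logDeriv_prod {K ι : Type*} [Field K] (d : Derivation ℤ K K) (s : Finset ι)
    (f : ι → K) (hf : ∀ i ∈ s, f i ≠ 0) :
    d (∏ i ∈ s, f i) / ∏ i ∈ s, f i = ∑ i ∈ s, d (f i) / f i := by
  classical
  induction s using Finset.induction_on with
  | empty => simp
  | insert a s ha ih =>
    rw [Finset.prod_insert ha, Finset.sum_insert ha, d.logDeriv_mul (hf a (by simp)),
      ih fun i hi => hf i (by simp [hi])]
    exact Finset.prod_ne_zero_iff.mpr fun i hi => hf i (by simp [hi])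

end Derivations

section RationalFunctions

open Polynomial

variable {k E : Type*} [Field k] [Field E] [Algebra k[X] E]

/-- The rational function `f` is regular at `x`, with value `y`. -/
def HasValueAt (x : k) (f : E) (y : k) : Prop :=
  ∃ u v : k[X], v.eval x ≠ 0 ∧ f = algebraMap k[X] E u / algebraMap k[X] E v ∧
    y = u.eval x / v.eval x

theorem algebraMap_ne_zero_of_eval_ne_zero [IsFractionRing k[X] E] {x : k} {v : k[X]}
    (hv : v.eval x ≠ 0) : algebraMap k[X] E v ≠ 0 := by
  rw [ne_eq, IsFractionRing.to_map_eq_zero_iff]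
  rintro rfl
  simp at hv

namespace HasValueAt

variable {x y z : k} {f g : E}

theorem of_polynomial (x : k) (p : k[X]) : HasValueAt x (algebraMap k[X] E p) (p.eval x) :=
  ⟨p, 1, by simp, by simp, by simp⟩

theorem zero (x : k) : HasValueAt x (0 : E) 0 := by
  simpa using HasValueAt.of_polynomial (E := E) x 0

theorem add [IsFractionRing k[X] E] (hf : HasValueAt x f y) (hg : HasValueAt x g z) :
    HasValueAt x (f + g) (y + z) := by
  obtain ⟨u, v, hv, rfl, rfl⟩ := hf
  obtain ⟨u', v', hv', rfl, rfl⟩ := hg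
  have h1 := algebraMap_ne_zero_of_eval_ne_zero (E := E) hv
  have h2 := algebraMap_ne_zero_of_eval_ne_zero (E := E) hv'
  refine ⟨u * v' + u' * v, v * v', by simp [hv, hv'], ?_, ?_⟩
  · simp only [map_add, map_mul]
    field_simp
  · simp only [eval_add, eval_mul]
    field_simp

theorem mul (hf : HasValueAt x f y) (hg : HasValueAt x g z) : HasValueAt x (f * g) (y * z) := by
  obtain ⟨u, v, hv, rfl, rfl⟩ := hf
  obtain ⟨u', v', hv', rfl, rfl⟩ := hg
  refine ⟨u * u', v * v', by simp [hv, hv'], ?_, ?_⟩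
  · simp only [map_mul, div_mul_div_comm]
  · simp only [eval_mul, div_mul_div_comm]

theorem inv (hf : HasValueAt x f y) (hy : y ≠ 0) : HasValueAt x f⁻¹ y⁻¹ := by
  obtain ⟨u, v, hv, rfl, rfl⟩ := hf
  exact ⟨v, u, fun h => hy (by simp [h]), by simp, by simp⟩

theorem div (hf : HasValueAt x f y) (hg : HasValueAt x g z) (hz : z ≠ 0) :
    HasValueAt x (f / g) (y / z) := by
  rw [div_eq_mul_inv, div_eq_mul_inv]
  exact hf.mul (hg.inv hz)

theorem neg (hf : HasValueAt x f y) : HasValueAt x (-f) (-y) := by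
  simpa using (HasValueAt.of_polynomial (E := E) x (-1)).mul hf

theorem sub [IsFractionRing k[X] E] (hf : HasValueAt x f y) (hg : HasValueAt x g z) :
    HasValueAt x (f - g) (y - z) := by
  rw [sub_eq_add_neg, sub_eq_add_neg]
  exact hf.add hg.neg

theorem sum [IsFractionRing k[X] E] {ι : Type*} {s : Finset ι} {f : ι → E} {y : ι → k}
    (h : ∀ i ∈ s, HasValueAt x (f i) (y i)) : HasValueAt x (∑ i ∈ s, f i) (∑ i ∈ s, y i) := by
  classical
  induction s using Finset.induction_on with
  | empty => simpa using zero x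
  | insert a s ha ih =>
    rw [Finset.sum_insert ha, Finset.sum_insert ha]
    exact (h a (by simp)).add (ih fun i hi => h i (by simp [hi]))

theorem unique [IsFractionRing k[X] E] (hf : HasValueAt x f y) (hf' : HasValueAt x f z) :
    y = z := by
  obtain ⟨u, v, hv, rfl, rfl⟩ := hf
  obtain ⟨u', v', hv', h, rfl⟩ := hf'
  have h1 := algebraMap_ne_zero_of_eval_ne_zero (E := E) hv
  have h2 := algebraMap_ne_zero_of_eval_ne_zero (E := E) hv'
  rw [div_eq_div_iff h1 h2, ← map_mul, ← map_mul] at h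
  have h := congrArg (Polynomial.eval x) (IsFractionRing.injective k[X] E h)
  rw [div_eq_div_iff hv hv']
  simpa using h

/-- Evaluation at a constant commutes with the coefficientwise extension of a derivation. -/
theorem derivation [IsFractionRing k[X] E] {δ : Derivation ℤ k k} {D : Derivation ℤ E E}
    (hC : ∀ a, D (algebraMap k[X] E (C a)) = algebraMap k[X] E (C (δ a)))
    (hX : D (algebraMap k[X] E X) = 0) (hx : δ x = 0) (hf : HasValueAt x f y) :
    HasValueAt x (D f) (δ y) := by
  have hp (p : k[X]) : HasValueAt x (D (algebraMap k[X] E p)) (δ (p.eval x)) := by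
    induction p using Polynomial.induction_on' with
    | add p q hp hq =>
      simp only [map_add, eval_add]
      exact hp.add hq
    | monomial n a =>
      rw [← C_mul_X_pow_eq_monomial]
      have h1 : D (algebraMap k[X] E (C a * X ^ n)) = algebraMap k[X] E (C (δ a) * X ^ n) := by
        rw [map_mul, map_pow, Derivation.leibniz, Derivation.leibniz_pow, hX, hC, smul_zero,
          smul_zero, smul_zero, zero_add, smul_eq_mul, map_mul, map_pow, mul_comm]
      have h2 : δ ((C a * X ^ n).eval x) = (C (δ a) * X ^ n).eval x := by
        rw [eval_mul, eval_C, eval_pow, eval_X, Derivation.leibniz, Derivation.leibniz_pow, hx,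
          smul_zero, smul_zero, smul_zero, zero_add, smul_eq_mul, eval_mul, eval_C, eval_pow,
          eval_X, mul_comm]
      rw [h1, h2]
      exact of_polynomial x _
  obtain ⟨u, v, hv, rfl, rfl⟩ := hf
  have hu := HasValueAt.of_polynomial (E := E) x u
  have hw := HasValueAt.of_polynomial (E := E) x v
  rw [Derivation.leibniz_div, Derivation.leibniz_div]
  simp only [smul_eq_mul]
  have h2 := (hw.inv hv).mul (hw.inv hv)
  rw [pow_two, pow_two]
  exact h2.mul ((hw.mul (hp u)).sub (hu.mul (hp v)))

end HasValueAt

section Residues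

variable [IsFractionRing k[X] E] {d : Derivation ℤ E E}

theorem exists_eq_C_of_derivation_eq_zero [CharZero k]
    (hd : ∀ p : k[X], d (algebraMap k[X] E p) = algebraMap k[X] E (derivative p)) {f : E}
    (hf : d f = 0) :
    ∃ c : k, f = algebraMap k[X] E (C c) := by
  obtain ⟨u, v, hcop, rfl⟩ : ∃ u v : k[X], IsCoprime u v ∧
      f = algebraMap k[X] E u / algebraMap k[X] E v := by
    obtain ⟨u, v, h, e⟩ := IsFractionRing.exists_reduced_fraction k[X] f
    exact ⟨u, v, h.isCoprime, by rw [← e, IsFractionRing.mk'_eq_div]⟩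
  by_cases hv : v = 0
  · exact ⟨0, by simp [hv]⟩
  have hv' : algebraMap k[X] E v ≠ 0 := by rwa [ne_eq, IsFractionRing.to_map_eq_zero_iff]
  rw [Derivation.leibniz_div, hd, hd] at hf
  simp only [smul_eq_mul, mul_eq_zero, pow_eq_zero_iff, ne_eq, OfNat.ofNat_ne_zero,
    not_false_eq_true, inv_eq_zero, hv', false_or, ← map_mul, ← map_sub,
    IsFractionRing.to_map_eq_zero_iff] at hf
  have h1 : v ∣ derivative v := by
    refine hcop.symm.dvd_of_dvd_mul_left ⟨derivative u, ?_⟩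
    linear_combination -hf
  have h2 : derivative v = 0 := by
    by_contra h
    exact absurd (degree_le_of_dvd h1 h) (not_le.mpr (degree_derivative_lt hv))
  have h3 : derivative u = 0 := by
    rw [h2, mul_zero, sub_zero] at hf
    exact (mul_eq_zero.mp hf).resolve_left hv
  rw [eq_C_of_derivative_eq_zero h2, eq_C_of_derivative_eq_zero h3]
  refine ⟨u.coeff 0 / v.coeff 0, ?_⟩
  have h4 : v.coeff 0 ≠ 0 := fun h => hv (by rw [eq_C_of_derivative_eq_zero h2, h, C_0])
  rw [div_eq_iff, ← map_mul, ← C_mul, div_mul_cancel₀ _ h4]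
  rwa [ne_eq, IsFractionRing.to_map_eq_zero_iff, C_eq_zero]

/-- A derivative has no simple poles. -/
theorem eval_eq_zero_of_derivation_eq [CharZero k]
    (hd : ∀ p : k[X], d (algebraMap k[X] E p) = algebraMap k[X] E (derivative p))
    {β : k} {N y : k[X]} {g : E}
    (hy : y.eval β ≠ 0)
    (h : d g = algebraMap k[X] E N / algebraMap k[X] E ((X - C β) * y)) : N.eval β = 0 := by
  obtain ⟨u, v, hcop, rfl⟩ : ∃ u v : k[X], IsCoprime u v ∧
      g = algebraMap k[X] E u / algebraMap k[X] E v := by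
    obtain ⟨u, v, h, e⟩ := IsFractionRing.exists_reduced_fraction k[X] g
    exact ⟨u, v, h.isCoprime, by rw [← e, IsFractionRing.mk'_eq_div]⟩
  have hy0 : y ≠ 0 := by rintro rfl; simp at hy
  have hden : algebraMap k[X] E ((X - C β) * y) ≠ 0 := by
    rw [ne_eq, IsFractionRing.to_map_eq_zero_iff]
    exact mul_ne_zero (X_sub_C_ne_zero β) hy0
  by_cases hv : v = 0
  · simp only [hv, map_zero, div_zero] at h
    rw [eq_comm, div_eq_zero_iff, or_iff_left hden, IsFractionRing.to_map_eq_zero_iff] at h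
    simp [h]
  have hv' : algebraMap k[X] E v ≠ 0 := by rwa [ne_eq, IsFractionRing.to_map_eq_zero_iff]
  have key : (v * derivative u - u * derivative v) * ((X - C β) * y) = N * v ^ 2 := by
    apply IsFractionRing.injective k[X] E
    rw [Derivation.leibniz_div, hd, hd] at h
    simp only [smul_eq_mul] at h
    rw [eq_div_iff hden] at h
    rw [map_mul, map_mul _ N, ← h]
    simp only [map_sub, map_mul, map_pow]
    field_simp
  by_contra hN
  by_cases hvβ : v.eval β = 0
  · obtain ⟨w, hw, hwβ⟩ := exists_eq_pow_rootMultiplicity_mul_and_not_dvd v hv β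
    have hn := (rootMultiplicity_pos hv).mpr hvβ
    obtain ⟨n, hn'⟩ : ∃ n, rootMultiplicity β v = n + 1 := ⟨_, (Nat.succ_pred_eq_of_pos hn).symm⟩
    rw [hn'] at hw
    rw [dvd_iff_isRoot, IsRoot.def] at hwβ
    have huβ : u.eval β ≠ 0 := by
      intro hu
      obtain ⟨a, b, hab⟩ := hcop
      simpa [hu, hvβ] using congrArg (Polynomial.eval β) hab
    have hder : derivative v = (X - C β) ^ n * (C (n + 1 : k) * w + (X - C β) * derivative w) := by
      rw [hw, derivative_mul, derivative_X_sub_C_pow]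
      simp only [Nat.add_sub_cancel, Nat.cast_add, Nat.cast_one, pow_succ]
      ring
    have key2 : (X - C β) ^ (n + 1) * (((X - C β) * w * derivative u -
        u * (C (n + 1 : k) * w + (X - C β) * derivative w)) * y) =
        (X - C β) ^ (n + 1) * ((X - C β) ^ (n + 1) * N * w ^ 2) := by
      rw [hder] at key
      have e : v = (X - C β) ^ (n + 1) * w := hw
      rw [e] at key
      linear_combination key
    have key3 := mul_left_cancel₀ (pow_ne_zero _ (X_sub_C_ne_zero β)) key2
    have := congrArg (Polynomial.eval β) key3
    simp [huβ, hwβ, hy] at this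
    exact Nat.cast_add_one_ne_zero n this
  · have := congrArg (Polynomial.eval β) key
    simp [hN, hvβ] at this

/-- Integration of rational functions with split denominator: a rational function is the sum of a
derivative and of simple poles with constant coefficients, all away from the points where the
denominator does not vanish. -/
theorem exists_eq_derivation_add_sum [CharZero k] [IsAlgClosed k]
    (hd : ∀ p : k[X], d (algebraMap k[X] E p) = algebraMap k[X] E (derivative p))
    (u v : k[X]) (hv : v ≠ 0) :
    ∃ (R : E) (c : k →₀ k),
      algebraMap k[X] E u / algebraMap k[X] E v =
        d R + ∑ α ∈ c.support, algebraMap k[X] E (C (c α)) / algebraMap k[X] E (X - C α) ∧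
      ∀ x, v.eval x ≠ 0 → (∃ y, HasValueAt x R y) ∧ c x = 0 := by
  classical
  induction hn : v.natDegree generalizing u v with
  | zero =>
    obtain ⟨a, rfl⟩ := natDegree_eq_zero.mp hn
    obtain ⟨w, hw⟩ : ∃ w : k[X], derivative w = u := by
      induction u using Polynomial.induction_on' with
      | add p q hp hq =>
        obtain ⟨w₁, rfl⟩ := hp
        obtain ⟨w₂, rfl⟩ := hq
        exact ⟨w₁ + w₂, by simp⟩
      | monomial n b =>
        refine ⟨monomial (n + 1) (b / (n + 1)), ?_⟩
        rw [derivative_monomial]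
        simp [div_mul_cancel₀ _ (Nat.cast_add_one_ne_zero (R := k) n)]
    have ha : a ≠ 0 := fun h => hv (by simp [h])
    refine ⟨algebraMap k[X] E (C a⁻¹ * w), 0, ?_, fun x _ => ⟨⟨_, .of_polynomial x _⟩, rfl⟩⟩
    have haE : algebraMap k[X] E (C a) ≠ 0 := by
      rwa [ne_eq, IsFractionRing.to_map_eq_zero_iff, C_eq_zero]
    rw [hd, derivative_C_mul, hw, div_eq_iff haE]
    simp only [Finsupp.support_zero, Finset.sum_empty, add_zero]
    rw [← map_mul, mul_right_comm, ← C_mul, inv_mul_cancel₀ ha, C_1, one_mul]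
  | succ N ih =>
    obtain ⟨α, hα⟩ := IsAlgClosed.exists_root v (fun h => by
      rw [natDegree_eq_of_degree_eq_some h] at hn; simp at hn)
    obtain ⟨w, hw, hwα⟩ := exists_eq_pow_rootMultiplicity_mul_and_not_dvd v hv α
    obtain ⟨n, hn'⟩ : ∃ n, rootMultiplicity α v = n + 1 :=
      ⟨_, (Nat.succ_pred_eq_of_pos ((rootMultiplicity_pos hv).mpr hα)).symm⟩
    rw [hn'] at hw
    rw [dvd_iff_isRoot, IsRoot.def] at hwα
    have hw0 : w ≠ 0 := by rintro rfl; simp at hwα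
    set e := u.eval α / w.eval α with he
    obtain ⟨u', hu'⟩ : X - C α ∣ u - C e * w := by
      rw [dvd_iff_isRoot, IsRoot.def]
      simp [he, div_mul_cancel₀ _ hwα]
    have hXα : (X - C α : k[X]) ≠ 0 := X_sub_C_ne_zero α
    have hv'0 : (X - C α) ^ n * w ≠ 0 := mul_ne_zero (pow_ne_zero _ hXα) hw0
    obtain ⟨R, c, hRc, hreg⟩ := ih u' ((X - C α) ^ n * w) hv'0 (by
      have : v = (X - C α) * ((X - C α) ^ n * w) := by rw [hw]; ring
      rw [this, natDegree_mul hXα hv'0, natDegree_X_sub_C] at hn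
      omega)
    have hXE : algebraMap k[X] E (X - C α) ≠ 0 := by
      rwa [ne_eq, IsFractionRing.to_map_eq_zero_iff]
    have hwE : algebraMap k[X] E w ≠ 0 := by
      rwa [ne_eq, IsFractionRing.to_map_eq_zero_iff]
    have hsplit : algebraMap k[X] E u / algebraMap k[X] E v =
        algebraMap k[X] E (C e) / algebraMap k[X] E (X - C α) ^ (n + 1) +
        algebraMap k[X] E u' / algebraMap k[X] E ((X - C α) ^ n * w) := by
      rw [eq_add_of_sub_eq hu', hw]
      simp only [map_add, map_mul, map_pow]
      field_simp
      ring
    have hvx (x : k) (hx : v.eval x ≠ 0) : ((X - C α) ^ n * w).eval x ≠ 0 ∧ x - α ≠ 0 := by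
      rw [hw, pow_succ, mul_right_comm, eval_mul] at hx
      refine ⟨left_ne_zero_of_mul hx, ?_⟩
      simpa using right_ne_zero_of_mul hx
    rcases Nat.eq_zero_or_pos n with rfl | hnpos
    · refine ⟨R, c + Finsupp.single α e, ?_, fun x hx => ⟨(hreg x (hvx x hx).1).1, ?_⟩⟩
      · have hsum (c : k →₀ k) :
            ∑ α ∈ c.support, algebraMap k[X] E (C (c α)) / algebraMap k[X] E (X - C α) =
            c.sum fun α y => algebraMap k[X] E (C y) / algebraMap k[X] E (X - C α) := rfl
        rw [hsplit, hRc, hsum, hsum, Finsupp.sum_add_index' (by simp)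
          (by intros; simp [add_div]), Finsupp.sum_single_index (by simp)]
        simp only [zero_add, pow_one]
        ring
      · rw [Finsupp.add_apply, (hreg x (hvx x hx).1).2, Finsupp.single_apply,
          if_neg (fun h => (hvx x hx).2 (by rw [h, sub_self])), add_zero]
    · have hnE : (n : E) ≠ 0 := by
        rw [← map_natCast (algebraMap k[X] E), ne_eq, IsFractionRing.to_map_eq_zero_iff]
        exact_mod_cast hnpos.ne'
      have hnk : (n : k) ≠ 0 := by exact_mod_cast hnpos.ne'
      set T : E := algebraMap k[X] E (C (-e / n)) / algebraMap k[X] E (X - C α) ^ n with hT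
      refine ⟨T + R, c, ?_, fun x hx => ⟨?_, (hreg x (hvx x hx).1).2⟩⟩
      · rw [hsplit, hRc, map_add, add_assoc, add_left_inj, hT, Derivation.leibniz_div,
          Derivation.leibniz_pow, hd, hd]
        obtain ⟨m, rfl⟩ : ∃ m, n = m + 1 := ⟨n - 1, by omega⟩
        have hC : algebraMap k[X] E (C e) = -((m + 1 : ℕ) : E) *
            algebraMap k[X] E (C (-e / (m + 1 : ℕ))) := by
          rw [← map_natCast (algebraMap k[X] E), ← map_neg, ← map_mul, ← C_eq_natCast, ← C_neg,
            ← C_mul]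
          congr 2
          field_simp
        rw [hC]
        simp only [derivative_C, derivative_sub, derivative_X, sub_zero, map_zero, map_one,
          smul_eq_mul, mul_zero, zero_sub, nsmul_eq_mul, mul_one, Nat.add_sub_cancel]
        field_simp
        ring
      · obtain ⟨y, hy⟩ := (hreg x (hvx x hx).1).1
        refine ⟨_, HasValueAt.add (y := (-e / n) / (x - α) ^ n) ?_ hy⟩
        have := (HasValueAt.of_polynomial (E := E) x (C (-e / n))).div
          (HasValueAt.of_polynomial x ((X - C α) ^ n))
          (by simpa using fun h => absurd h (hvx x hx).2)
        simpa [hT] using this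

/-- If `∂_i A` is an `X`-derivative for every derivation `∂_i` of the coefficients, then the
residues of `A` are constants and the increments of the `X`-antiderivatives of `∂_i A` are of
Liouville form. -/
theorem exists_sub_eq_derivation_add_sum_logDeriv [CharZero k] [IsAlgClosed k] {ι : Type*}
    (hd : ∀ p : k[X], d (algebraMap k[X] E p) = algebraMap k[X] E (derivative p))
    {δ : ι → Derivation ℤ k k} {D : ι → Derivation ℤ E E}
    (hC : ∀ i a, D i (algebraMap k[X] E (C a)) = algebraMap k[X] E (C (δ i a)))
    (hX : ∀ i, D i (algebraMap k[X] E X) = 0) (hcomm : ∀ i f, D i (d f) = d (D i f))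
    {u v : k[X]} {x₀ x₁ : k} (hv₀ : v.eval x₀ ≠ 0) (hv₁ : v.eval x₁ ≠ 0)
    (hx₀ : ∀ i, δ i x₀ = 0) (hx₁ : ∀ i, δ i x₁ = 0) {B : ι → E} {b₀ b₁ : ι → k}
    (hB₀ : ∀ i, HasValueAt x₀ (B i) (b₀ i)) (hB₁ : ∀ i, HasValueAt x₁ (B i) (b₁ i))
    (hB : ∀ i, D i (algebraMap k[X] E u / algebraMap k[X] E v) = d (B i)) :
    ∃ (g : k) (c : k →₀ k), c x₀ = 0 ∧ c x₁ = 0 ∧ (∀ i α, δ i (c α) = 0) ∧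
      ∀ i, b₁ i - b₀ i = δ i g + ∑ α ∈ c.support,
        c α * (δ i (x₁ - α) / (x₁ - α) - δ i (x₀ - α) / (x₀ - α)) := by
  classical
  have hv : v ≠ 0 := by rintro rfl; simp at hv₀
  obtain ⟨R, c, hA, hreg⟩ := exists_eq_derivation_add_sum (E := E) hd u v hv
  have hXE (α : k) : algebraMap k[X] E (X - C α) ≠ 0 := by
    rw [ne_eq, IsFractionRing.to_map_eq_zero_iff]
    exact X_sub_C_ne_zero α
  have hDX (i) (α : k) : D i (algebraMap k[X] E (X - C α)) = - algebraMap k[X] E (C (δ i α)) := by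
    rw [map_sub, map_sub, hX, hC, zero_sub]
  have hpole (i) (α e : k) : D i (algebraMap k[X] E (C e) / algebraMap k[X] E (X - C α)) =
      algebraMap k[X] E (C (δ i e)) / algebraMap k[X] E (X - C α) +
      d (algebraMap k[X] E (C e) *
        (D i (algebraMap k[X] E (X - C α)) / algebraMap k[X] E (X - C α))) := by
    have h1 := hXE α
    rw [hDX, ← map_neg, ← mul_div_assoc, ← map_mul, Derivation.leibniz_div, Derivation.leibniz_div,
      hd, hd, hDX, hC, ← C_neg, ← C_mul]
    simp only [derivative_C, derivative_sub, derivative_X, sub_zero, map_zero, map_one,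
      smul_eq_mul, mul_zero, zero_sub, mul_one]
    simp only [map_neg, map_mul]
    field_simp
    ring
  set G : ι → E := fun i => B i - D i R - ∑ α ∈ c.support, algebraMap k[X] E (C (c α)) *
        (D i (algebraMap k[X] E (X - C α)) / algebraMap k[X] E (X - C α)) with hG
  have hdG (i) : d (G i) = ∑ α ∈ c.support,
      algebraMap k[X] E (C (δ i (c α))) / algebraMap k[X] E (X - C α) := by
    have h := hB i
    rw [hA, map_add, map_sum, Finset.sum_congr rfl fun α _ => hpole i α (c α),
      Finset.sum_add_distrib, ← map_sum, hcomm] at h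
    rw [hG]
    rw [map_sub, map_sub, ← h]
    ring
  have hres (i) (β : k) : δ i (c β) = 0 := by
    by_cases hβ : β ∈ c.support
    · have hsum : HasValueAt β (∑ α ∈ c.support.erase β,
          algebraMap k[X] E (C (δ i (c α))) / algebraMap k[X] E (X - C α))
          (∑ α ∈ c.support.erase β, (C (δ i (c α))).eval β / (X - C α).eval β) := by
        refine HasValueAt.sum fun α hα => (HasValueAt.of_polynomial _ _).div
          (HasValueAt.of_polynomial _ _) ?_
        rw [eval_sub, eval_X, eval_C]
        exact sub_ne_zero.mpr (Finset.ne_of_mem_erase hα).symm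
      obtain ⟨a, b, hb, hab, -⟩ := hsum
      have h := hdG i
      rw [← Finset.add_sum_erase _ _ hβ, hab] at h
      have hbE := algebraMap_ne_zero_of_eval_ne_zero (E := E) hb
      have hN := eval_eq_zero_of_derivation_eq hd (β := β)
        (N := C (δ i (c β)) * b + (X - C β) * a) hb (g := G i) (by
          rw [h, map_add, map_mul, map_mul, map_mul, div_add_div _ _ (hXE β) hbE])
      simpa [hb] using hN
    · rw [Finsupp.notMem_support_iff.mp hβ, map_zero]
  have hconst (i) : ∃ e, G i = algebraMap k[X] E (C e) := by
    refine exists_eq_C_of_derivation_eq_zero hd ?_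
    rw [hdG]
    exact Finset.sum_eq_zero fun α _ => by rw [hres, C_0, map_zero, zero_div]
  have hval {x y : k} {b : ι → k} (hx : ∀ i, δ i x = 0) (hy : HasValueAt x R y) (hc : c x = 0)
      (hb : ∀ i, HasValueAt x (B i) (b i)) (i) : HasValueAt x (G i)
        (b i - δ i y - ∑ α ∈ c.support, c α * (δ i (x - α) / (x - α))) := by
    refine ((hb i).sub (hy.derivation (hC i) (hX i) (hx i))).sub (HasValueAt.sum fun α hα => ?_)
    have hα' : x - α ≠ 0 := by
      rintro h
      rw [sub_eq_zero] at h
      rw [Finsupp.mem_support_iff, ← h] at hα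
      exact hα hc
    have h1 : HasValueAt x (algebraMap k[X] E (X - C α)) (x - α) := by
      have := HasValueAt.of_polynomial (E := E) x (X - C α)
      rwa [eval_sub, eval_X, eval_C] at this
    have h2 : HasValueAt x (algebraMap k[X] E (C (c α))) (c α) := by
      simpa using HasValueAt.of_polynomial (E := E) x (C (c α))
    exact h2.mul ((h1.derivation (hC i) (hX i) (hx i)).div h1 hα')
  obtain ⟨⟨y₀, hy₀⟩, hc₀⟩ := hreg x₀ hv₀
  obtain ⟨⟨y₁, hy₁⟩, hc₁⟩ := hreg x₁ hv₁
  refine ⟨y₁ - y₀, c, hc₀, hc₁, hres, fun i => ?_⟩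
  obtain ⟨e, he⟩ := hconst i
  have hC' (x : k) : HasValueAt x (G i) e := by
    rw [he]
    simpa using HasValueAt.of_polynomial (E := E) x (C e)
  have e₀ := (hval hx₀ hy₀ hc₀ hB₀ i).unique (hC' x₀)
  have e₁ := (hval hx₁ hy₁ hc₁ hB₁ i).unique (hC' x₁)
  simp only [mul_sub, Finset.sum_sub_distrib, map_sub] at *
  linear_combination e₁ - e₀

end Residues

end RationalFunctions

section Homotopy

variable {F K k E σ : Type*} [Field F] [Field K] [Field k] [Field E]
  [Algebra (MvPolynomial σ F) K] [IsFractionRing (MvPolynomial σ F) K] [Algebra K k]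
  [Algebra (Polynomial k) E] [IsFractionRing (Polynomial k) E]

/-- Operators satisfying the Leibniz rule along a ring homomorphism out of a fraction field agree
as soon as they agree on the base ring. -/
theorem eq_of_leibniz_of_eqOn {R K E : Type*} [CommRing R] [IsDomain R] [Field K] [Algebra R K]
    [IsFractionRing R K] [Field E] (φ : K →+* E) {T₁ T₂ : K → E}
    (h₁ : ∀ a b, T₁ (a * b) = φ a * T₁ b + φ b * T₁ a)
    (h₂ : ∀ a b, T₂ (a * b) = φ a * T₂ b + φ b * T₂ a)
    (h : ∀ r, T₁ (algebraMap R K r) = T₂ (algebraMap R K r)) (f : K) : T₁ f = T₂ f := by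
  obtain ⟨n, q, hq, rfl⟩ := IsFractionRing.div_surjective (A := R) f
  have hq0 : algebraMap R K q ≠ 0 := by
    rw [ne_eq, IsFractionRing.to_map_eq_zero_iff]
    exact nonZeroDivisors.ne_zero hq
  have e₁ := h₁ (algebraMap R K n / algebraMap R K q) (algebraMap R K q)
  have e₂ := h₂ (algebraMap R K n / algebraMap R K q) (algebraMap R K q)
  rw [div_mul_cancel₀ _ hq0] at e₁ e₂
  have hφ : φ (algebraMap R K q) ≠ 0 := by rwa [ne_eq, map_eq_zero]
  apply mul_left_cancel₀ hφ
  linear_combination e₂ - e₁ + h n - φ (algebraMap R K n / algebraMap R K q) * h q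

theorem eq_of_leibniz_of_eqOn_mvPolynomial {E : Type*} [Field E]
    (φ : MvPolynomial σ F →+* E) {T₁ T₂ : MvPolynomial σ F → E}
    (h₁ : ∀ a b, T₁ (a * b) = φ a * T₁ b + φ b * T₁ a)
    (h₂ : ∀ a b, T₂ (a * b) = φ a * T₂ b + φ b * T₂ a)
    (h₁' : ∀ a b, T₁ (a + b) = T₁ a + T₁ b) (h₂' : ∀ a b, T₂ (a + b) = T₂ a + T₂ b)
    (hC : ∀ c, T₁ (MvPolynomial.C c) = T₂ (MvPolynomial.C c))
    (hX : ∀ i, T₁ (MvPolynomial.X i) = T₂ (MvPolynomial.X i)) (f : MvPolynomial σ F) :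
    T₁ f = T₂ f := by
  induction f using MvPolynomial.induction_on with
  | C c => exact hC c
  | add p q hp hq => rw [h₁', h₂', hp, hq]
  | mul_X p i hp => rw [h₁, h₂, hp, hX]

/-- Restriction of rational functions to the line `s ↦ p + s (t - p)` joining a rational point `p`
to the generic point `t`, together with the chain rules. -/
theorem exists_line_restriction [Fintype σ] [DecidableEq σ]
    {D : σ → Derivation ℤ K K} {δ : σ → Derivation ℤ k k}
    {Δ : σ → Derivation ℤ E E} {d : Derivation ℤ E E}
    (hD : ∀ i p, D i (algebraMap (MvPolynomial σ F) K p) =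
      algebraMap (MvPolynomial σ F) K (MvPolynomial.pderiv i p))
    (hδ : ∀ i f, δ i (algebraMap K k f) = algebraMap K k (D i f))
    (hC : ∀ i a, Δ i (algebraMap (Polynomial k) E (.C a)) =
      algebraMap (Polynomial k) E (.C (δ i a)))
    (hX : ∀ i, Δ i (algebraMap (Polynomial k) E .X) = 0)
    (hd : ∀ p, d (algebraMap (Polynomial k) E p) =
      algebraMap (Polynomial k) E (Polynomial.derivative p)) (p : σ → F) :
    ∃ (φ : K →+* E) (x : σ → k),
      (∀ n, ∃ u : Polynomial k,
        φ (algebraMap (MvPolynomial σ F) K n) = algebraMap (Polynomial k) E u ∧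
        u.eval 1 = algebraMap K k (algebraMap (MvPolynomial σ F) K n) ∧
        u.eval 0 = algebraMap K k (algebraMap (MvPolynomial σ F) K
          (MvPolynomial.C (MvPolynomial.eval p n)))) ∧
      (∀ i f, Δ i (φ f) = algebraMap (Polynomial k) E .X * φ (D i f)) ∧
      (∀ f, d (φ f) = ∑ j, algebraMap (Polynomial k) E (.C (x j)) * φ (D j f)) ∧
      ∀ i j, δ i (x j) = if i = j then 1 else 0 := by
  let ψ : MvPolynomial σ F →+* k := (algebraMap K k).comp (algebraMap (MvPolynomial σ F) K)
  let x : σ → k := fun j => ψ (MvPolynomial.X j - MvPolynomial.C (p j))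
  let l : MvPolynomial σ F →+* Polynomial k := MvPolynomial.eval₂Hom
    (Polynomial.C.comp (ψ.comp MvPolynomial.C))
    (fun j => Polynomial.C (ψ (MvPolynomial.C (p j))) + Polynomial.X * Polynomial.C (x j))
  have hlC (c : F) : l (MvPolynomial.C c) = Polynomial.C (ψ (MvPolynomial.C c)) := by simp [l]
  have hlX (j : σ) : l (MvPolynomial.X j) =
      Polynomial.C (ψ (MvPolynomial.C (p j))) + Polynomial.X * Polynomial.C (x j) := by simp [l]
  have hl1 (n) : (l n).eval 1 = ψ n := by
    have : (Polynomial.evalRingHom 1).comp l = ψ := by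
      apply MvPolynomial.ringHom_ext
      · intro c
        simp [hlC]
      · intro j
        simp [hlX, x]
    exact congrArg (fun f => f n) this
  have hl0 (n) : (l n).eval 0 = ψ (MvPolynomial.C (MvPolynomial.eval p n)) := by
    have : (Polynomial.evalRingHom 0).comp l =
        (ψ.comp MvPolynomial.C).comp (MvPolynomial.eval p) := by
      apply MvPolynomial.ringHom_ext
      · intro c
        simp [hlC]
      · intro j
        simp [hlX]
    exact congrArg (fun f => f n) this
  have hψ : Function.Injective ψ :=
    (algebraMap K k).injective.comp (IsFractionRing.injective (MvPolynomial σ F) K)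
  have hl : Function.Injective l := fun a b h => hψ (by rw [← hl1, ← hl1, h])
  have hlE : Function.Injective ((algebraMap (Polynomial k) E).comp l) :=
    (IsFractionRing.injective (Polynomial k) E).comp hl
  let φ : K →+* E := IsFractionRing.lift hlE
  have hφ (n) : φ (algebraMap (MvPolynomial σ F) K n) = algebraMap (Polynomial k) E (l n) :=
    IsFractionRing.lift_algebraMap hlE n
  have hδψ (i n) : δ i (ψ n) = ψ (MvPolynomial.pderiv i n) := by
    change δ i (algebraMap K k _) = _
    rw [hδ, hD]
    rfl
  have hx (i j) : δ i (x j) = if i = j then 1 else 0 := by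
    rw [hδψ, map_sub, MvPolynomial.pderiv_X, MvPolynomial.pderiv_C, sub_zero, Pi.single_apply]
    simp only [eq_comm (a := j)]
    split_ifs <;> simp
  refine ⟨φ, x, fun n => ⟨l n, hφ n, hl1 n, hl0 n⟩, fun i => ?_, ?_, hx⟩
  · refine eq_of_leibniz_of_eqOn (R := MvPolynomial σ F) φ ?_ ?_ ?_
    · intro a b
      rw [map_mul, Derivation.leibniz, smul_eq_mul, smul_eq_mul]
    · intro a b
      rw [Derivation.leibniz, smul_eq_mul, smul_eq_mul, map_add, map_mul, map_mul]
      ring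
    · refine eq_of_leibniz_of_eqOn_mvPolynomial (φ.comp (algebraMap _ K)) ?_ ?_ ?_ ?_ ?_ ?_
      · intro a b
        rw [map_mul, map_mul, Derivation.leibniz, smul_eq_mul, smul_eq_mul]
        rfl
      · intro a b
        rw [map_mul, Derivation.leibniz, smul_eq_mul, smul_eq_mul, map_add, map_mul, map_mul]
        simp only [RingHom.comp_apply]
        ring
      · intro a b
        simp only [map_add]
      · intro a b
        simp only [map_add, mul_add]
      · intro c
        rw [hφ, hlC, hC, hδψ, hD, MvPolynomial.pderiv_C]
        simp
      · intro j
        rw [hφ, hlX, map_add, map_add, map_mul, Derivation.leibniz, hX, hC, hC, hδψ, hx, hD,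
          MvPolynomial.pderiv_C, MvPolynomial.pderiv_X, Pi.single_apply]
        simp only [eq_comm (a := j)]
        split_ifs <;> simp
  · refine eq_of_leibniz_of_eqOn (R := MvPolynomial σ F) φ ?_ ?_ ?_
    · intro a b
      rw [map_mul, Derivation.leibniz, smul_eq_mul, smul_eq_mul]
    · intro a b
      simp only [Derivation.leibniz, smul_eq_mul, map_add, map_mul, mul_add,
        Finset.sum_add_distrib, Finset.mul_sum]
      congr 1 <;> exact Finset.sum_congr rfl fun _ _ => by ring
    · refine eq_of_leibniz_of_eqOn_mvPolynomial (φ.comp (algebraMap _ K)) ?_ ?_ ?_ ?_ ?_ ?_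
      · intro a b
        rw [map_mul, map_mul, Derivation.leibniz, smul_eq_mul, smul_eq_mul]
        rfl
      · intro a b
        simp only [Derivation.leibniz, smul_eq_mul, map_add, map_mul, mul_add,
          Finset.sum_add_distrib, Finset.mul_sum, RingHom.comp_apply]
        congr 1 <;> exact Finset.sum_congr rfl fun _ _ => by ring
      · intro a b
        simp only [map_add]
      · intro a b
        simp only [map_add, mul_add, Finset.sum_add_distrib]
      · intro c
        rw [hφ, hlC, hd]
        simp [hD]
      · intro j
        rw [hφ, hlX, hd]
        simp [hD, MvPolynomial.pderiv_X, Pi.single_apply, apply_ite]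

theorem exists_eval_ne_zero [Infinite F] {q : MvPolynomial σ F} (hq : q ≠ 0) :
    ∃ p : σ → F, MvPolynomial.eval p q ≠ 0 := by
  by_contra! h
  exact hq (MvPolynomial.funext fun p => by rw [h p, map_zero])

/-- A rational function all of whose partial derivatives vanish is constant. -/
theorem exists_eq_C_of_forall_derivation_eq_zero [CharZero F] [CharZero k] [Fintype σ]
    {D : σ → Derivation ℤ K K} {δ : σ → Derivation ℤ k k}
    {Δ : σ → Derivation ℤ E E} {d : Derivation ℤ E E}
    (hD : ∀ i p, D i (algebraMap (MvPolynomial σ F) K p) =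
      algebraMap (MvPolynomial σ F) K (MvPolynomial.pderiv i p))
    (hδ : ∀ i f, δ i (algebraMap K k f) = algebraMap K k (D i f))
    (hC : ∀ i a, Δ i (algebraMap (Polynomial k) E (.C a)) =
      algebraMap (Polynomial k) E (.C (δ i a)))
    (hX : ∀ i, Δ i (algebraMap (Polynomial k) E .X) = 0)
    (hd : ∀ p, d (algebraMap (Polynomial k) E p) =
      algebraMap (Polynomial k) E (Polynomial.derivative p))
    {f : K} (hf : ∀ i, D i f = 0) :
    ∃ c : F, f = algebraMap (MvPolynomial σ F) K (MvPolynomial.C c) := by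
  classical
  obtain ⟨n, q, hq, rfl⟩ := IsFractionRing.div_surjective (A := MvPolynomial σ F) f
  obtain ⟨p, hp⟩ := exists_eval_ne_zero (nonZeroDivisors.ne_zero hq)
  obtain ⟨φ, x, hφ, -, hdφ, -⟩ := exists_line_restriction hD hδ hC hX hd p
  obtain ⟨u, hu, hu1, hu0⟩ := hφ n
  obtain ⟨v, hv, hv1, hv0⟩ := hφ q
  obtain ⟨e, he⟩ := exists_eq_C_of_derivation_eq_zero hd
    (f := φ (algebraMap _ K n / algebraMap _ K q)) (by
      rw [hdφ]; simp only [hf, map_zero, mul_zero, Finset.sum_const_zero])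
  have hv1' : v.eval 1 ≠ 0 := by
    rw [hv1, ne_eq, map_eq_zero, IsFractionRing.to_map_eq_zero_iff]
    exact nonZeroDivisors.ne_zero hq
  have hv0' : v.eval 0 ≠ 0 := by
    rw [hv0, ne_eq, map_eq_zero, IsFractionRing.to_map_eq_zero_iff, MvPolynomial.C_eq_zero]
    exact hp
  rw [map_div₀, hu, hv] at he
  have hval (y : k) (hy : v.eval y ≠ 0) : u.eval y / v.eval y = e := by
    refine HasValueAt.unique (E := E) (x := y) ⟨u, v, hy, rfl, rfl⟩ ?_
    rw [he]
    have := HasValueAt.of_polynomial (E := E) y (Polynomial.C e)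
    rwa [Polynomial.eval_C] at this
  have h := (hval 1 hv1').trans (hval 0 hv0').symm
  rw [hu1, hv1, hu0, hv0, ← map_div₀ (algebraMap K k), ← map_div₀ (algebraMap K k)] at h
  refine ⟨MvPolynomial.eval p n / MvPolynomial.eval p q, ?_⟩
  rw [(algebraMap K k).injective h, div_eq_iff, ← map_mul, ← map_mul, div_mul_cancel₀ _ hp]
  rwa [ne_eq, IsFractionRing.to_map_eq_zero_iff, MvPolynomial.C_eq_zero]

end Homotopy

section Liouville

variable {F K k E σ : Type*} [Field F] [Field K] [Field k] [Field E]
  [Algebra (MvPolynomial σ F) K] [IsFractionRing (MvPolynomial σ F) K] [Algebra K k]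
  [Algebra (Polynomial k) E] [IsFractionRing (Polynomial k) E]

/-- The minimal polynomial of a constant has constant coefficients. -/
theorem derivation_coeff_minpoly_eq_zero {K k : Type*} [Field K] [Field k] [Algebra K k]
    {D : Derivation ℤ K K} {δ : Derivation ℤ k k}
    (hδ : ∀ f, δ (algebraMap K k f) = algebraMap K k (D f)) {c : k} (hc : IsIntegral K c)
    (h : δ c = 0) (n : ℕ) : D ((minpoly K c).coeff n) = 0 := by
  set p := minpoly K c with hp
  let r : Polynomial K :=
    ∑ j ∈ Finset.range (p.natDegree + 1), Polynomial.monomial j (D (p.coeff j))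
  have hr (j : ℕ) : r.coeff j = D (p.coeff j) := by
    simp only [r, Polynomial.finsetSum_coeff, Polynomial.coeff_monomial, Finset.sum_ite_eq',
      Finset.mem_range]
    split_ifs with hj
    · rfl
    · rw [Polynomial.coeff_eq_zero_of_natDegree_lt (by omega), map_zero]
  have hrc : Polynomial.aeval c r = 0 := by
    have h0 : δ (Polynomial.aeval c p) = 0 := by rw [hp, minpoly.aeval, map_zero]
    rw [Polynomial.aeval_eq_sum_range, map_sum] at h0
    rw [map_sum, ← h0]
    refine Finset.sum_congr rfl fun j _ => ?_
    rw [Polynomial.aeval_monomial, Algebra.smul_def, Derivation.leibniz, Derivation.leibniz_pow, h,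
      hδ]
    simp [mul_comm]
  have hr0 : r = 0 := by
    by_contra hne
    have h1 := Polynomial.natDegree_le_natDegree (minpoly.degree_le_of_ne_zero K c hne hrc)
    have h2 : r.natDegree ≤ p.natDegree := by
      rw [Polynomial.natDegree_le_iff_coeff_eq_zero]
      intro j hj
      rw [hr, Polynomial.coeff_eq_zero_of_natDegree_lt hj, map_zero]
    have h3 : r.coeff r.natDegree = 0 := by
      rw [hr, le_antisymm h2 h1, Polynomial.coeff_natDegree, (minpoly.monic hc).leadingCoeff,
        Derivation.map_one_eq_zero]
    exact hne (Polynomial.leadingCoeff_eq_zero.mp h3)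
  rw [← hr, hr0, Polynomial.coeff_zero]

/-- Constants of an algebraic extension are algebraic over, hence contained in, the algebraically
closed field of constants. -/
theorem mem_range_of_forall_derivation_eq_zero {F K k σ : Type*} [Field F] [IsAlgClosed F]
    [Field K] [Field k] [Algebra F K] [Algebra K k] [Algebra.IsAlgebraic K k]
    {D : σ → Derivation ℤ K K} {δ : σ → Derivation ℤ k k}
    (hδ : ∀ i f, δ i (algebraMap K k f) = algebraMap K k (D i f))
    (hD : ∀ f, (∀ i, D i f = 0) → ∃ c : F, f = algebraMap F K c) {c : k}
    (hc : ∀ i, δ i c = 0) : ∃ γ : F, c = algebraMap K k (algebraMap F K γ) := by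
  have hint : IsIntegral K c := Algebra.IsIntegral.isIntegral c
  obtain ⟨P, hP⟩ := (Polynomial.lifts_iff_coeff_lifts (f := algebraMap F K) (minpoly K c)).mpr
    fun n => by
      obtain ⟨γ, hγ⟩ := hD _ fun i => derivation_coeff_minpoly_eq_zero (hδ i) hint (hc i) n
      exact ⟨γ, hγ.symm⟩
  have hP' : P.map (algebraMap F K) = minpoly K c := hP
  have hP0 : P ≠ 0 := by
    rintro rfl
    rw [Polynomial.map_zero] at hP'
    exact minpoly.ne_zero hint hP'.symm
  have hroot : (P.map ((algebraMap K k).comp (algebraMap F K))).IsRoot c := by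
    rw [← Polynomial.map_map, hP', Polynomial.IsRoot.def, Polynomial.eval_map_algebraMap,
      minpoly.aeval]
  obtain ⟨γ, hγ⟩ := (IsAlgClosed.splits P).mem_range_of_isRoot hP0 hroot
  exact ⟨γ, hγ.symm⟩

/-- Closed rational one-forms have Liouville form over an algebraically closed algebraic
extension of the field of rational functions. -/
theorem exists_eq_derivation_add_sum_logDeriv [CharZero F] [IsAlgClosed F] [Finite σ]
    [CharZero k] [IsAlgClosed k] [Algebra.IsAlgebraic K k] [Algebra F K]
    [IsScalarTower F (MvPolynomial σ F) K] {D : σ → Derivation ℤ K K} {δ : σ → Derivation ℤ k k}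
    {Δ : σ → Derivation ℤ E E} {d : Derivation ℤ E E}
    (hD : ∀ i p, D i (algebraMap (MvPolynomial σ F) K p) =
      algebraMap (MvPolynomial σ F) K (MvPolynomial.pderiv i p))
    (hδ : ∀ i f, δ i (algebraMap K k f) = algebraMap K k (D i f))
    (hC : ∀ i a, Δ i (algebraMap (Polynomial k) E (.C a)) =
      algebraMap (Polynomial k) E (.C (δ i a)))
    (hX : ∀ i, Δ i (algebraMap (Polynomial k) E .X) = 0)
    (hd : ∀ p, d (algebraMap (Polynomial k) E p) =
      algebraMap (Polynomial k) E (Polynomial.derivative p))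
    (hcomm : ∀ i f, Δ i (d f) = d (Δ i f))
    {a : σ → K} (ha : ∀ i j, D i (a j) = D j (a i)) :
    ∃ (g : k) (s : Finset k) (γ : k → F) (h : k → k), (∀ α ∈ s, h α ≠ 0) ∧
      ∀ i, algebraMap K k (a i) =
        δ i g + ∑ α ∈ s, algebraMap K k (algebraMap F K (γ α)) * (δ i (h α) / h α) := by
  classical
  have := Fintype.ofFinite σ
  obtain ⟨q, hq⟩ := IsLocalization.exist_integer_multiples_of_finite
    (nonZeroDivisors (MvPolynomial σ F)) a
  have hq0 : (q : MvPolynomial σ F) ≠ 0 := nonZeroDivisors.ne_zero q.2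
  choose n hn using hq
  have hqK : algebraMap (MvPolynomial σ F) K q ≠ 0 := by
    rwa [ne_eq, IsFractionRing.to_map_eq_zero_iff]
  have haq (j) : a j =
      algebraMap (MvPolynomial σ F) K (n j) / algebraMap (MvPolynomial σ F) K q := by
    rw [hn, eq_div_iff hqK, mul_comm, Algebra.smul_def]
  obtain ⟨p, hp⟩ := exists_eval_ne_zero hq0
  obtain ⟨φ, x, hφ, hφΔ, hφd, hx⟩ := exists_line_restriction hD hδ hC hX hd p
  choose l hφ hl1 hl0 using hφ
  have hinj := (algebraMap K k).injective
  have hv1 : (l q).eval 1 ≠ 0 := by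
    rwa [hl1, ne_eq, map_eq_zero]
  have hv0 : (l q).eval 0 ≠ 0 := by
    rw [hl0, ne_eq, map_eq_zero, IsFractionRing.to_map_eq_zero_iff, MvPolynomial.C_eq_zero]
    exact hp
  have hφa (j) : φ (a j) = algebraMap (Polynomial k) E (l (n j)) /
      algebraMap (Polynomial k) E (l q) := by
    rw [haq, map_div₀, hφ, hφ]
  have hA : algebraMap (Polynomial k) E (∑ j, .C (x j) * l (n j)) /
      algebraMap (Polynomial k) E (l q) =
      ∑ j, algebraMap (Polynomial k) E (.C (x j)) * φ (a j) := by
    rw [map_sum, Finset.sum_div]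
    exact Finset.sum_congr rfl fun j _ => by rw [hφa, map_mul, mul_div_assoc]
  obtain ⟨g, c, hc0, hc1, hc, hg⟩ := exists_sub_eq_derivation_add_sum_logDeriv hd hC hX hcomm
    (v := l q) (u := ∑ j, .C (x j) * l (n j)) (x₀ := 0) (x₁ := 1) hv0 hv1 (fun i => map_zero _)
    (fun i => Derivation.map_one_eq_zero _)
    (B := fun i => algebraMap (Polynomial k) E .X * φ (a i))
    (b₀ := fun i => 0 * ((l (n i)).eval 0 / (l q).eval 0))
    (b₁ := fun i => 1 * ((l (n i)).eval 1 / (l q).eval 1))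
    (fun i => by
      have := HasValueAt.of_polynomial (E := E) (0 : k) .X
      rw [Polynomial.eval_X] at this
      exact this.mul ⟨_, _, hv0, hφa i, rfl⟩)
    (fun i => by
      have := HasValueAt.of_polynomial (E := E) (1 : k) .X
      rw [Polynomial.eval_X] at this
      exact this.mul ⟨_, _, hv1, hφa i, rfl⟩)
    (fun i => by
      rw [hA, map_sum, Derivation.leibniz, hφd, hd, Polynomial.derivative_X, map_one]
      simp only [Derivation.leibniz, smul_eq_mul, hC, hx, hφΔ, Finset.sum_add_distrib, mul_one]
      rw [Finset.mul_sum]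
      congr 1
      · exact Finset.sum_congr rfl fun j _ => by rw [ha j i]; ring
      · rw [Finset.sum_eq_single i]
        · simp
        · intro j _ hj
          simp [hj.symm]
        · simp)
  have hconst (f : K) (hf : ∀ i, D i f = 0) : ∃ c : F, f = algebraMap F K c := by
    obtain ⟨c, hc⟩ := exists_eq_C_of_forall_derivation_eq_zero hD hδ hC hX hd hf
    exact ⟨c, by rw [hc, IsScalarTower.algebraMap_apply F (MvPolynomial σ F) K]; rfl⟩
  choose γ hγ using fun α => mem_range_of_forall_derivation_eq_zero hδ hconst fun i => hc i α
  have h0 {α : k} (hα : α ∈ c.support) : 0 - α ≠ 0 := by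
    intro h
    rw [sub_eq_zero] at h
    exact Finsupp.mem_support_iff.mp hα (h ▸ hc0)
  have h1 {α : k} (hα : α ∈ c.support) : 1 - α ≠ 0 := by
    intro h
    rw [sub_eq_zero] at h
    exact Finsupp.mem_support_iff.mp hα (h ▸ hc1)
  refine ⟨g, c.support, γ, fun α => (1 - α) / (0 - α), fun α hα => div_ne_zero (h1 hα) (h0 hα),
    fun i => ?_⟩
  have := hg i
  simp only [zero_mul, sub_zero, one_mul] at this
  rw [haq, map_div₀, ← hl1, ← hl1, this]
  congr 1
  refine Finset.sum_congr rfl fun α hα => ?_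
  rw [← hγ]
  congr 1
  have e := (δ i).logDeriv_mul (div_ne_zero (h1 hα) (h0 hα)) (h0 hα)
  rw [div_mul_cancel₀ _ (h0 hα)] at e
  simp only [zero_sub] at e ⊢
  linear_combination e

end Liouville

section Descent

/-- Derivations compatible on `A` along `τ : B → C` are compatible on `B` when `A → B` is formally
unramified. -/
theorem Derivation.map_eq_of_formallyUnramified {A B C : Type*} [CommRing A] [CommRing B]
    [CommRing C] [Algebra A B] [Algebra.FormallyUnramified A B] (τ : B →+* C)
    (d : Derivation ℤ B B) (d' : Derivation ℤ C C)
    (h : ∀ a, d' (τ (algebraMap A B a)) = τ (d (algebraMap A B a))) (b : B) :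
    d' (τ b) = τ (d b) := by
  let _ : Module B C := Module.compHom C τ
  have hsmul (x : B) (y : C) : x • y = τ x * y := rfl
  let d₁ : Derivation ℤ B C := Derivation.mk' (d'.toLinearMap.toAddMonoidHom.comp
    τ.toAddMonoidHom).toIntLinearMap (fun x y => by
      change d' (τ (x * y)) = τ x * d' (τ y) + τ y * d' (τ x)
      rw [map_mul, Derivation.leibniz, smul_eq_mul, smul_eq_mul])
  let d₂ : Derivation ℤ B C := Derivation.mk' (τ.toAddMonoidHom.comp
    d.toLinearMap.toAddMonoidHom).toIntLinearMap (fun x y => by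
      change τ (d (x * y)) = τ x * τ (d y) + τ y * τ (d x)
      rw [Derivation.leibniz, smul_eq_mul, smul_eq_mul, map_add, map_mul, map_mul])
  exact congrArg (fun e => e b) (Derivation.eq_of_formallyUnramified (A := A) d₁ d₂ h)

variable {K k : Type*} [Field K] [Field k] [Algebra K k] [CharZero K]

theorem exists_derivation_extension_of_isAlgebraic [Algebra.IsAlgebraic K k]
    (D : Derivation ℤ K K) :
    ∃ δ : Derivation ℤ k k, ∀ f, δ (algebraMap K k f) = algebraMap K k (D f) := by
  have := Algebra.FormallyEtale.of_isSeparable K k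
  exact ((Algebra.linearMap K k).compDer D).exists_extension_of_formallyEtale

/-- A one-form over `K` of Liouville form over an algebraic extension is of Liouville form over
`K`, by taking traces and norms. -/
theorem exists_eq_derivation_add_sum_logDeriv_of_isAlgebraic [Algebra.IsAlgebraic K k]
    [IsAlgClosed k] {F σ : Type*} [Field F] [Algebra F K] {D : σ → Derivation ℤ K K}
    {δ : σ → Derivation ℤ k k} (hδ : ∀ i f, δ i (algebraMap K k f) = algebraMap K k (D i f))
    {a : σ → K} {g : k} {s : Finset k} {γ : k → F} {h : k → k} (hh : ∀ α ∈ s, h α ≠ 0)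
    (ha : ∀ i, algebraMap K k (a i) =
        δ i g + ∑ α ∈ s, algebraMap K k (algebraMap F K (γ α)) * (δ i (h α) / h α)) :
    ∃ (g₀ : K) (γ' : k → F) (h' : k → K), (∀ α ∈ s, h' α ≠ 0) ∧
      ∀ i, a i = D i g₀ + ∑ α ∈ s, algebraMap F K (γ' α) * (D i (h' α) / h' α) := by
  classical
  let S : Finset k := insert g (s.image h)
  let L := IntermediateField.adjoin K (S : Set k)
  have hLf : FiniteDimensional K L := IntermediateField.finiteDimensional_adjoin
    fun x _ => Algebra.IsIntegral.isIntegral x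
  have hLu : Algebra.FormallyEtale K L := Algebra.FormallyEtale.of_isSeparable K L
  have hS {x : k} (hx : x ∈ S) : x ∈ L := IntermediateField.subset_adjoin K _ hx
  have hgL : g ∈ L := hS (by simp [S])
  have hhL (α : k) (hα : α ∈ s) : h α ∈ L :=
    hS (Finset.mem_insert_of_mem (Finset.mem_image_of_mem h hα))
  let g' : L := ⟨g, hgL⟩
  let y : k → L := fun α => if hα : α ∈ s then ⟨h α, hhL α hα⟩ else 1
  have hy {α : k} (hα : α ∈ s) : (y α : k) = h α := by simp [y, hα]
  have hy0 (α : k) (hα : α ∈ s) : y α ≠ 0 := by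
    intro h0
    apply hh α hα
    rw [← hy hα, h0, ZeroMemClass.coe_zero]
  choose δL hδL using fun i => exists_derivation_extension_of_isAlgebraic (k := L) (D i)
  have hτ (i) (τ : L →ₐ[K] k) (z : L) : δ i (τ z) = τ (δL i z) := by
    refine Derivation.map_eq_of_formallyUnramified (A := K) (τ : L →+* k) (δL i) (δ i)
      (fun f => ?_) z
    rw [hδL]
    simp [hδ]
  have hL (i) : algebraMap K L (a i) = δL i g' +
      ∑ α ∈ s, algebraMap K L (algebraMap F K (γ α)) * (δL i (y α) / y α) := by
    have hval (z : L) : algebraMap L k (δL i z) = δ i z := (hτ i L.val z).symm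
    apply (algebraMap L k).injective
    rw [← IsScalarTower.algebraMap_apply, ha, map_add, map_sum, hval]
    congr 1
    refine Finset.sum_congr rfl fun α hα => ?_
    rw [map_mul, ← IsScalarTower.algebraMap_apply K L k, map_div₀, hval]
    change _ = _ * (δ i (y α : k) / (y α : k))
    rw [hy hα]
  have htr (i) (z : L) : Algebra.trace K L (δL i z) = D i (Algebra.trace K L z) := by
    apply (algebraMap K k).injective
    rw [trace_eq_sum_embeddings, ← hδ, trace_eq_sum_embeddings, map_sum]
    exact Finset.sum_congr rfl fun τ _ => (hτ i τ z).symm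
  have hnorm (i) (z : L) (hz : z ≠ 0) : Algebra.trace K L (δL i z / z) =
      D i (Algebra.norm K z) / Algebra.norm K z := by
    apply (algebraMap K k).injective
    rw [trace_eq_sum_embeddings, map_div₀, ← hδ, Algebra.norm_eq_prod_embeddings K k z,
      Derivation.logDeriv_prod _ _ _ fun τ _ => by simpa using hz]
    exact Finset.sum_congr rfl fun τ _ => by rw [map_div₀, hτ]
  have hN : (Module.finrank K L : K) ≠ 0 := Nat.cast_ne_zero.mpr Module.finrank_pos.ne'
  have hDN (i) : D i (Module.finrank K L : K)⁻¹ = 0 := by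
    rw [Derivation.leibniz_inv, Derivation.map_natCast, smul_zero]
  refine ⟨(Module.finrank K L : K)⁻¹ * Algebra.trace K L g',
    fun α => (Module.finrank K L : F)⁻¹ * γ α, fun α => Algebra.norm K (y α),
    fun α hα => Algebra.norm_ne_zero_iff.mpr (hy0 α hα), fun i => ?_⟩
  have e := congrArg (Algebra.trace K L) (hL i)
  rw [Algebra.trace_algebraMap, map_add, map_sum, htr, Finset.sum_congr rfl fun α hα => by
    rw [← Algebra.smul_def, map_smul, hnorm i _ (hy0 α hα), smul_eq_mul], nsmul_eq_mul] at e
  rw [Derivation.leibniz, hDN, smul_zero, add_zero, smul_eq_mul]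
  simp only [map_mul, map_inv₀, map_natCast, mul_assoc]
  rw [← Finset.mul_sum, ← mul_add, ← e, inv_mul_cancel_left₀ hN]

end Descent

section Existence

/-- The coefficientwise extension of a derivation to polynomials. -/
theorem exists_coefficientwise_derivation {k : Type*} [Field k] (δ : Derivation ℤ k k) :
    ∃ Δ : Derivation ℤ (Polynomial k) (Polynomial k),
      (∀ n a, Δ (Polynomial.monomial n a) = Polynomial.monomial n (δ a)) := by
  refine ⟨PolynomialModule.equivPolynomialSelf.toLinearMap.compDer δ.mapCoeffs, fun n a => ?_⟩
  simp

/-- A derivation of the coefficients and the derivation by the variable extend to commuting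
derivations on rational functions. -/
theorem exists_commuting_derivations {k E ι : Type*} [Field k] [Field E] [Algebra (Polynomial k) E]
    [IsFractionRing (Polynomial k) E] (δ : ι → Derivation ℤ k k) :
    ∃ (Δ : ι → Derivation ℤ E E) (d : Derivation ℤ E E),
      (∀ i a, Δ i (algebraMap (Polynomial k) E (.C a)) =
        algebraMap (Polynomial k) E (.C (δ i a))) ∧
      (∀ i, Δ i (algebraMap (Polynomial k) E .X) = 0) ∧
      (∀ p, d (algebraMap (Polynomial k) E p) =
        algebraMap (Polynomial k) E (Polynomial.derivative p)) ∧
      ∀ i f, Δ i (d f) = d (Δ i f) := by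
  have := Algebra.FormallyEtale.of_isLocalization (Rₘ := E) (nonZeroDivisors (Polynomial k))
  have hext (D : Derivation ℤ (Polynomial k) (Polynomial k)) : ∃ D' : Derivation ℤ E E,
      ∀ p, D' (algebraMap _ E p) = algebraMap _ E (D p) :=
    ((Algebra.linearMap (Polynomial k) E).compDer D).exists_extension_of_formallyEtale
  choose Δ₀ hΔ₀ using fun i => exists_coefficientwise_derivation (δ i)
  choose Δ hΔ using fun i => hext (Δ₀ i)
  obtain ⟨d, hd⟩ := hext (Polynomial.derivative'.restrictScalars ℤ)
  have hd' (p) : d (algebraMap (Polynomial k) E p) =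
      algebraMap (Polynomial k) E (Polynomial.derivative p) := hd p
  refine ⟨Δ, d, fun i a => ?_, fun i => ?_, hd', fun i f => ?_⟩
  · rw [hΔ, ← Polynomial.monomial_zero_left, hΔ₀, Polynomial.monomial_zero_left]
  · rw [hΔ, ← Polynomial.monomial_one_one_eq_X, hΔ₀, Derivation.map_one_eq_zero,
      Polynomial.monomial_zero_right, map_zero]
  · have h0 : ⁅Δ i, d⁆ = 0 := by
      refine Derivation.eq_of_formallyUnramified (A := Polynomial k) _ _ fun p => ?_
      rw [Derivation.commutator_apply, hd', hΔ, hΔ, hd', ← map_sub, Derivation.zero_apply]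
      convert map_zero (algebraMap (Polynomial k) E)
      induction p using Polynomial.induction_on' with
      | add p q hp hq =>
        simp only [map_add] at *
        linear_combination hp + hq
      | monomial n a =>
        rw [hΔ₀, Polynomial.derivative_monomial, Polynomial.derivative_monomial, hΔ₀]
        simp [Derivation.leibniz, mul_comm]
    have := congrArg (fun e => e f) h0
    rwa [Derivation.commutator_apply, Derivation.zero_apply, sub_eq_zero] at this

end Existence

section Main

/-- Multivariate Christopher's theorem for an arbitrary model of the field of rational functions. -/
theorem exists_eq_derivation_add_sum_logDeriv_of_isFractionRing {F K σ : Type*} [Field F]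
    [IsAlgClosed F] [CharZero F] [Finite σ] [Field K] [Algebra F K]
    [Algebra (MvPolynomial σ F) K] [IsScalarTower F (MvPolynomial σ F) K]
    [IsFractionRing (MvPolynomial σ F) K] (D : σ → Derivation F K K)
    (hD : ∀ i p, D i (algebraMap (MvPolynomial σ F) K p) =
      algebraMap (MvPolynomial σ F) K (MvPolynomial.pderiv i p))
    {a : σ → K} (ha : ∀ i j, D i (a j) = D j (a i)) :
    ∃ (L : ℕ) (g₀ : K) (g : Fin L → K) (γ : Fin L → F), (∀ l, g l ≠ 0) ∧
      ∀ i, a i = D i g₀ + ∑ l, algebraMap F K (γ l) * (D i (g l) / g l) := by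
  let k := AlgebraicClosure K
  let D' : σ → Derivation ℤ K K := fun i => (D i).restrictScalars ℤ
  have : CharZero K := charZero_of_injective_algebraMap (algebraMap F K).injective
  have : CharZero k := charZero_of_injective_algebraMap (algebraMap K k).injective
  choose δ hδ using fun i => exists_derivation_extension_of_isAlgebraic (k := k) (D' i)
  obtain ⟨Δ, d, hC, hX, hd, hcomm⟩ :=
    exists_commuting_derivations (E := FractionRing (Polynomial k)) δ
  obtain ⟨g, s, γ, h, hh, hg⟩ := exists_eq_derivation_add_sum_logDeriv (F := F) (D := D')
    hD hδ hC hX hd hcomm ha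
  obtain ⟨g₀, γ', h', hh', hg'⟩ :=
    exists_eq_derivation_add_sum_logDeriv_of_isAlgebraic hδ hh hg
  refine ⟨s.card, g₀, fun l => h' (s.equivFin.symm l), fun l => γ' (s.equivFin.symm l),
    fun l => hh' _ (s.equivFin.symm l).2, fun i => ?_⟩
  rw [hg' i, ← Finset.sum_coe_sort]
  congr 1
  exact (Equiv.sum_comp s.equivFin.symm fun α : s =>
    algebraMap F K (γ' α) * (D i (h' α) / h' α)).symm

end Main

open MvPolynomial

/-- **Multivariate Christopher's theorem.**
`F` is an algebraically closed field of characteristic zero, `K = F(t_1, …, t_m)` is the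
field of rational functions (the fraction field of `F[t_1, …, t_m]`), and for each `i`,
`D i` is the unique derivation on `K` extending the partial derivative `∂/∂t_i` on
`F[t_1, …, t_m]`.  If `a_1, …, a_m ∈ K` satisfy `D_i(a_j) = D_j(a_i)` for all `i < j`,
then there are `L : ℕ`, rational functions `g_0, g_1, …, g_L ∈ K` with `g_1, …, g_L`
nonzero, and constants `γ_1, …, γ_L ∈ F` such that
`a_i = D_i(g_0) + Σ_ℓ γ_ℓ · D_i(g_ℓ)/g_ℓ` for every `i`. -/
theorem christopher_multivariate
    (F : Type*) [Field F] [IsAlgClosed F] [CharZero F] (m : ℕ)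
    (D : Fin m → Derivation F (FractionRing (MvPolynomial (Fin m) F))
      (FractionRing (MvPolynomial (Fin m) F)))
    (hD : ∀ i (p : MvPolynomial (Fin m) F),
      D i (algebraMap (MvPolynomial (Fin m) F) (FractionRing (MvPolynomial (Fin m) F)) p)
        = algebraMap (MvPolynomial (Fin m) F) (FractionRing (MvPolynomial (Fin m) F))
            (pderiv i p))
    (a : Fin m → FractionRing (MvPolynomial (Fin m) F))
    (hcompat : ∀ i j : Fin m, i < j → D i (a j) = D j (a i)) :
    ∃ (L : ℕ) (g₀ : FractionRing (MvPolynomial (Fin m) F))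
      (g : Fin L → FractionRing (MvPolynomial (Fin m) F)) (γ : Fin L → F),
      (∀ ℓ, g ℓ ≠ 0) ∧
      ∀ i, a i = D i g₀ + ∑ ℓ,
        algebraMap F (FractionRing (MvPolynomial (Fin m) F)) (γ ℓ) * (D i (g ℓ) / g ℓ) := by
  refine exists_eq_derivation_add_sum_logDeriv_of_isFractionRing D hD fun i j => ?_
  rcases lt_trichotomy i j with h | rfl | h
  · exact hcompat i j h
  · rfl
  · exact (hcompat j i h).symm
end

section
/- Let F be an algebraically closed field of characteristic zero and let b_1, …, b_n ∈ F(k_1, …, k_n) be nonzero rational functions satisfying b_i · S_i(b_j) = b_j · S_j(b_i) for all 1 ≤ i < j ≤ n. Then there exist a nonzero rational function f ∈ F(k_1, …, k_n), nonzero constants μ_1, …, μ_n ∈ F, a finite set V ⊂ ℤ^n \ {0}, and for each v = (v_1, …, v_n) ∈ V a univariate rational function r_v ∈ F(z) that is a quotient of two monic polynomials, such that for every j = 1, …, n one has b_j = (S_j(f)/f) · μ_j · ∏_{v ∈ V} ∏_0^{v_j} r_v(v·k + ℓ), where r_v(v·k + ℓ) denotes the result of substituting the element v_1 k_1 + ⋯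 + v_n k_n + ℓ of F(k_1, …, k_n) into r_v (this substitution is well defined and nonzero because v ≠ 0 makes v·k + ℓ a nonconstant polynomial). (Ore–Sato theorem.) -/
open MvPolynomial

/-- The two-sided product `∏_0^t α_ℓ`, defined as `∏_{ℓ=0}^{t−1} α_ℓ` if `t ≥ 0`
and as `∏_{ℓ=t}^{−1} α_ℓ⁻¹` if `t < 0`. -/
noncomputable def twoSidedProd {K : Type*} [Field K] (t : ℤ) (α : ℤ → K) : K :=
  if 0 ≤ t then ∏ ℓ ∈ Finset.range t.toNat, α ℓ
  else ∏ ℓ ∈ Finset.range (-t).toNat, (α (t + ℓ))⁻¹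

/-- The field of rational functions `F(k_1, …, k_n)`. -/
abbrev RatFuncField (F : Type*) [Field F] (n : ℕ) : Type _ :=
  FractionRing (MvPolynomial (Fin n) F)

section Combinatorics

/-- The `j`-th standard basis vector of `ℤ^n`. -/
abbrev unitShift {n : ℕ} (j : Fin n) : Fin n → ℤ := Pi.single j 1

variable {n : ℕ} {I : Type*} [AddAction (Fin n → ℤ) I]

/-- The divisor-valued form of the compatibility condition `b_i · S_i(b_j) = b_j · S_j(b_i)`. -/
def IsShiftCocycle (e : Fin n → I →₀ ℤ) : Prop :=
  ∀ i j p, e i p + e j (-unitShift i +ᵥ p) = e j p + e i (-unitShift j +ᵥ p)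

/-- The sum of the `ι p`-th component of `e` along the line through `p` in direction `ι p`. -/
noncomputable def lineSum (ι : I → Fin n) (e : Fin n → I →₀ ℤ) (p : I) : ℤ :=
  ∑' k : ℤ, e (ι p) (k • unitShift (ι p) +ᵥ p)

/-- Every vector with a nonzero multiple fixing a point already fixes that point. -/
def HasSaturatedStabilizers (n : ℕ) (I : Type*) [AddAction (Fin n → ℤ) I] : Prop :=
  ∀ (m : ℤ) (w : Fin n → ℤ) (p : I), m ≠ 0 → m • w +ᵥ p = p → w +ᵥ p = p

/-- `ι` selects, uniformly on orbits, a coordinate direction that moves each point. -/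
structure IsMovingDirection (ι : I → Fin n) : Prop where
  single_vadd_ne (p : I) : unitShift (ι p) +ᵥ p ≠ p
  apply_vadd (w : Fin n → ℤ) (p : I) : ι (w +ᵥ p) = ι p

lemma zsmul_vadd_injective (hfree : HasSaturatedStabilizers n I) {w : Fin n → ℤ} {p : I}
    (h : w +ᵥ p ≠ p) : Function.Injective (fun k : ℤ => k • w +ᵥ p) := by
  intro a b hab
  by_contra hne
  apply h
  apply hfree (a - b) w p (sub_ne_zero.2 hne)
  have : (-(b • w)) +ᵥ (a • w +ᵥ p) = -(b • w) +ᵥ (b • w +ᵥ p) := congrArg _ hab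
  rw [neg_vadd_vadd, vadd_vadd] at this
  rwa [sub_smul, sub_eq_neg_add]

lemma summable_zsmul_vadd (hfree : HasSaturatedStabilizers n I) {w : Fin n → ℤ} {p : I}
    (h : w +ᵥ p ≠ p) (f : I →₀ ℤ) : Summable (fun k : ℤ => f (k • w +ᵥ p)) := by
  apply summable_of_hasFiniteSupport
  exact (f.hasFiniteSupport.preimage (zsmul_vadd_injective hfree h).injOn)

lemma vadd_vadd_ne {w : Fin n → ℤ} {p : I} (h : w +ᵥ p ≠ p) (u : Fin n → ℤ) :
    w +ᵥ (u +ᵥ p) ≠ u +ᵥ p := by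
  intro hh
  apply h
  rw [vadd_comm] at hh
  exact vadd_left_cancel _ hh

lemma lineSum_sub_smul (hfree : HasSaturatedStabilizers n I) {ι : I → Fin n}
    (hι : IsMovingDirection ι) (e e' : Fin n → I →₀ ℤ) (c : ℤ) (p : I) :
    lineSum ι (e - c • e') p = lineSum ι e p - c * lineSum ι e' p := by
  have h1 := summable_zsmul_vadd hfree (hι.single_vadd_ne p) (e (ι p))
  have h2 := summable_zsmul_vadd hfree (hι.single_vadd_ne p) (e' (ι p))
  unfold lineSum
  rw [← h2.tsum_mul_left, ← h1.tsum_sub (h2.mul_left c)]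
  simp

lemma lineSum_single_vadd (hfree : HasSaturatedStabilizers n I) {ι : I → Fin n}
    (hι : IsMovingDirection ι) {e : Fin n → I →₀ ℤ} (he : IsShiftCocycle e) (j : Fin n) (p : I) :
    lineSum ι e (unitShift j +ᵥ p) = lineSum ι e p := by
  unfold lineSum
  rw [hι.apply_vadd]
  set i := ι p with hi
  have hp : unitShift i +ᵥ p ≠ p := hι.single_vadd_ne p
  have hp' := vadd_vadd_ne hp (unitShift j)
  have s1 := summable_zsmul_vadd hfree hp (e i)
  have s2 := summable_zsmul_vadd hfree hp' (e i)
  have s3 := summable_zsmul_vadd hfree hp' (e j)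
  have s4 : Summable (fun k : ℤ =>
      e j ((k - 1) • unitShift i +ᵥ (unitShift j +ᵥ p))) :=
    (Equiv.subRight (1 : ℤ)).summable_iff.2 s3
  rw [← sub_eq_zero, ← s2.tsum_sub s1]
  have key : ∀ k : ℤ, e i (k • unitShift i +ᵥ (unitShift j +ᵥ p))
      - e i (k • unitShift i +ᵥ p)
      = e j (k • unitShift i +ᵥ (unitShift j +ᵥ p))
        - e j ((k - 1) • unitShift i +ᵥ (unitShift j +ᵥ p)) := by
    intro k
    have := he i j (k • unitShift i +ᵥ (unitShift j +ᵥ p))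
    have h1 : -unitShift i +ᵥ (k • unitShift i +ᵥ (unitShift j +ᵥ p))
        = (k - 1) • unitShift i +ᵥ (unitShift j +ᵥ p) := by
      rw [vadd_vadd, sub_smul, one_smul, sub_eq_neg_add]
    have h2 : -unitShift j +ᵥ (k • unitShift i +ᵥ (unitShift j +ᵥ p))
        = k • unitShift i +ᵥ p := by
      rw [vadd_comm (k • unitShift i), neg_vadd_vadd]
    rw [h1, h2] at this
    linarith
  rw [tsum_congr key, s3.tsum_sub s4, sub_eq_zero]
  exact ((Equiv.subRight (1 : ℤ)).tsum_eq
    (fun k => e j (k • unitShift i +ᵥ (unitShift j +ᵥ p)))).symm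

lemma lineSum_vadd (hfree : HasSaturatedStabilizers n I) {ι : I → Fin n}
    (hι : IsMovingDirection ι) {e : Fin n → I →₀ ℤ} (he : IsShiftCocycle e) (w : Fin n → ℤ) :
    ∀ p : I, lineSum ι e (w +ᵥ p) = lineSum ι e p := by
  let H : AddSubgroup (Fin n → ℤ) :=
    { carrier := {w | ∀ p : I, lineSum ι e (w +ᵥ p) = lineSum ι e p}
      zero_mem' := by simp
      add_mem' := by
        intro a b ha hb p
        rw [add_vadd, ha, hb]
      neg_mem' := by
        intro a ha p
        have := ha (-a +ᵥ p)
        rw [vadd_neg_vadd] at this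
        exact this.symm }
  have : w ∈ H := by
    have hw : w = ∑ j, w j • unitShift j := by
      ext i
      simp [Finset.sum_apply, Pi.single_apply]
    rw [hw]
    have hj : ∀ j : Fin n, unitShift j ∈ H := fun j p => lineSum_single_vadd hfree hι he j p
    exact sum_mem fun j _ => zsmul_mem (hj j) _
  exact this

lemma exists_coboundary_of_lineSum_eq_zero (hfree : HasSaturatedStabilizers n I) {ι : I → Fin n}
    (hι : IsMovingDirection ι) {e : Fin n → I →₀ ℤ} (he : IsShiftCocycle e)
    (h0 : ∀ p, lineSum ι e p = 0) :
    ∃ f : I →₀ ℤ, ∀ j p, e j p = f (-unitShift j +ᵥ p) - f p := by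
  classical
  let E : Fin n → I → ℤ → ℤ := fun j p k => e j ((-k) • unitShift (ι p) +ᵥ p)
  have sE : ∀ j p, Summable (E j p) := fun j p =>
    (Equiv.neg ℤ).summable_iff.2 (summable_zsmul_vadd hfree (hι.single_vadd_ne p) (e j))
  have sN : ∀ j p, Summable (fun k : ℕ => E j p k) := fun j p =>
    (sE j p).comp_injective Nat.cast_injective
  have sN' : ∀ j p, Summable (fun k : ℕ => E j p (-(k + 1))) := fun j p =>
    (sE j p).comp_injective (i := fun k : ℕ => (-((k : ℤ) + 1))) (fun a b h => by
      simpa using h)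
  let f₀ : I → ℤ := fun p => -∑' k : ℕ, E (ι p) p k
  have hf₀ : ∀ j p, e j p = f₀ (-unitShift j +ᵥ p) - f₀ p := by
    intro j p
    simp only [f₀, hι.apply_vadd]
    set i := ι p with hi
    have s1 := sN i p
    have s2 := sN i (-unitShift j +ᵥ p)
    rw [neg_sub_neg, ← s1.tsum_sub s2]
    have key : ∀ k : ℕ, E i p k - E i (-unitShift j +ᵥ p) k
        = E j p k - E j p ((k + 1 : ℕ) : ℤ) := by
      intro k
      have := he i j ((-(k : ℤ)) • unitShift i +ᵥ p)
      simp only [E, hι.apply_vadd]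
      rw [← hi]
      have h1 : -unitShift i +ᵥ ((-(k : ℤ)) • unitShift i +ᵥ p)
          = (-((k + 1 : ℕ) : ℤ)) • unitShift i +ᵥ p := by
        rw [vadd_vadd]
        congr 1
        push_cast
        module
      rw [h1, vadd_comm] at this
      linarith
    have s3 : Summable (fun k : ℕ => E j p ((k + 1 : ℕ) : ℤ)) :=
      (summable_nat_add_iff (f := fun k : ℕ => E j p k) 1).2 (sN j p)
    rw [tsum_congr key, (sN j p).tsum_sub s3, (sN j p).tsum_eq_zero_add]
    simp [E]
  have hfin : f₀.support.Finite := by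
    let U : Set I := ⋃ i : Fin n, ⋃ q ∈ (e i).support,
      if ι q = i then
        (fun k : ℕ => (k : ℤ) • unitShift i +ᵥ q) ''
          {k : ℕ | ∃ k' : ℕ, k ≤ k' ∧ e i ((k' : ℤ) • unitShift i +ᵥ q) ≠ 0}
      else ∅
    have hU : U.Finite := by
      refine Set.finite_iUnion fun i => Set.Finite.biUnion (Finset.finite_toSet _) fun q _ => ?_
      split_ifs with hq
      · apply Set.Finite.image
        have hfs : {k : ℕ | e i ((k : ℤ) • unitShift i +ᵥ q) ≠ 0}.Finite := by
          have hinj : Function.Injective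
              (fun k : ℕ => (k : ℤ) • unitShift i +ᵥ q) :=
            (zsmul_vadd_injective hfree (hq ▸ hι.single_vadd_ne q)).comp Nat.cast_injective
          exact (e i).hasFiniteSupport.preimage hinj.injOn
        obtain ⟨N, hN⟩ := hfs.bddAbove
        refine (Set.finite_Iic N).subset ?_
        rintro k ⟨k', hk, hk'⟩
        exact hk.trans (hN hk')
      · exact Set.finite_empty
    refine hU.subset fun p hp => ?_
    have hp' : ∑' k : ℕ, E (ι p) p k ≠ 0 := fun h => hp (by simp [f₀, h])
    have hsum : ∑' k : ℕ, E (ι p) p k + ∑' k : ℕ, E (ι p) p (-(k + 1)) = 0 := by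
      rw [← tsum_of_nat_of_neg_add_one (sN _ _) (sN' _ _), ← h0 p]
      exact (Equiv.neg ℤ).tsum_eq (fun k => e (ι p) (k • unitShift (ι p) +ᵥ p))
    obtain ⟨k, hk⟩ : ∃ k : ℕ, E (ι p) p k ≠ 0 := by
      by_contra! hc
      exact hp' (by simp [hc])
    obtain ⟨k', hk'⟩ : ∃ k : ℕ, E (ι p) p (-(k + 1)) ≠ 0 := by
      by_contra! hc
      apply hp'
      simpa only [hc, tsum_zero, add_zero] using hsum
    simp only [U, Set.mem_iUnion]
    refine ⟨ι p, (-(k : ℤ)) • unitShift (ι p) +ᵥ p, Finsupp.mem_support_iff.2 hk, ?_⟩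
    rw [if_pos (hι.apply_vadd _ _)]
    refine ⟨k, ⟨k + (k' + 1), by omega, ?_⟩, ?_⟩
    · convert hk' using 2
      rw [vadd_vadd]
      congr 1
      push_cast
      module
    · simp only [vadd_vadd]
      rw [← add_smul]
      simp
  refine ⟨Finsupp.ofSupportFinite f₀ hfin, hf₀⟩

lemma exists_vadd_eq_of_lineSum_ne_zero (hfree : HasSaturatedStabilizers n I) {ι : I → Fin n}
    (hι : IsMovingDirection ι) {e : Fin n → I →₀ ℤ} (he : IsShiftCocycle e) {p : I}
    (hp : lineSum ι e p ≠ 0) (j : Fin n) :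
    ∃ d a : ℤ, d ≠ 0 ∧ (d • unitShift j + a • unitShift (ι p)) +ᵥ p = p := by
  have hex : ∀ m : ℤ, ∃ k : ℤ,
      e (ι p) (k • unitShift (ι p) +ᵥ (m • unitShift j +ᵥ p)) ≠ 0 := by
    intro m
    by_contra! hc
    apply hp
    rw [← lineSum_vadd hfree hι he (m • unitShift j) p]
    simp only [lineSum, hι.apply_vadd, hc, tsum_zero]
  choose k hk using hex
  obtain ⟨m, m', hne, heq⟩ := Finite.exists_ne_map_eq_of_infinite
    (fun m : ℤ => (⟨_, Finsupp.mem_support_iff.2 (hk m)⟩ : (e (ι p)).support))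
  simp only [Subtype.mk.injEq] at heq
  refine ⟨m - m', k m - k m', sub_ne_zero.2 hne, ?_⟩
  rw [vadd_vadd, vadd_vadd] at heq
  have := congrArg
    (fun x => -(k m' • unitShift (ι p) + m' • unitShift j) +ᵥ x) heq
  simp only [vadd_vadd, neg_add_cancel, zero_vadd] at this
  convert this using 2
  module

/-- A subgroup of cocycles is everything as soon as it contains the coboundaries and, for each
orbit on which line sums may be nonzero, an element with line sum concentrated there. -/
theorem mem_of_isShiftCocycle (hfree : HasSaturatedStabilizers n I) {ι : I → Fin n}
    (hι : IsMovingDirection ι) (A : AddSubgroup (Fin n → I →₀ ℤ))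
    (hcob : ∀ (f : I →₀ ℤ) (e : Fin n → I →₀ ℤ),
      (∀ j p, e j p = f (-unitShift j +ᵥ p) - f p) → e ∈ A)
    (hbasic : ∀ p : I, (∀ j, ∃ d a : ℤ, d ≠ 0 ∧
        (d • unitShift j + a • unitShift (ι p)) +ᵥ p = p) →
      ∃ B ∈ A, IsShiftCocycle B ∧ lineSum ι B p * lineSum ι B p = 1 ∧
        ∀ q, q ∉ AddAction.orbit (Fin n → ℤ) p → lineSum ι B q = 0)
    {e : Fin n → I →₀ ℤ} (he : IsShiftCocycle e) : e ∈ A := by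
  classical
  suffices H : ∀ (T : Finset I) (e : Fin n → I →₀ ℤ), IsShiftCocycle e →
      (∀ p, lineSum ι e p ≠ 0 → ∃ q ∈ T, p ∈ AddAction.orbit (Fin n → ℤ) q) → e ∈ A by
    refine H (Finset.univ.biUnion fun i => (e i).support) e he fun p hp => ?_
    obtain ⟨k, hk⟩ : ∃ k : ℤ, e (ι p) (k • unitShift (ι p) +ᵥ p) ≠ 0 := by
      by_contra! hc
      exact hp (by simp only [lineSum, hc, tsum_zero])
    refine ⟨_, Finset.mem_biUnion.2 ⟨ι p, Finset.mem_univ _, Finsupp.mem_support_iff.2 hk⟩, ?_⟩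
    exact ⟨-(k • unitShift (ι p)), neg_vadd_vadd _ _⟩
  intro T
  induction T using Finset.induction_on with
  | empty =>
    intro e he h
    obtain ⟨f, hf⟩ := exists_coboundary_of_lineSum_eq_zero hfree hι he fun p => by
      by_contra hp
      simpa using h p hp
    exact hcob f e hf
  | insert q T _ ih =>
    intro e he h
    by_cases hq : lineSum ι e q = 0
    · refine ih e he fun p hp => ?_
      obtain ⟨q', hq', ⟨w, hw⟩⟩ := h p hp
      rcases Finset.mem_insert.1 hq' with rfl | hq'
      · simp only at hw
        rw [← hw, lineSum_vadd hfree hι he] at hp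
        exact absurd hq hp
      · exact ⟨q', hq', w, hw⟩
    · obtain ⟨B, hBA, hBc, hB1, hB0⟩ :=
        hbasic q (exists_vadd_eq_of_lineSum_ne_zero hfree hι he hq)
      set c := lineSum ι e q * lineSum ι B q with hc
      have hc' : IsShiftCocycle (e - c • B) := by
        intro i j p
        have h1 := he i j p
        have h2 := hBc i j p
        simp only [Pi.sub_apply, Pi.smul_apply, Finsupp.sub_apply, Finsupp.smul_apply,
          smul_eq_mul]
        linear_combination h1 - c * h2
      have hmem : e - c • B ∈ A := by
        refine ih _ hc' fun p hp => ?_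
        have hpq : p ∉ AddAction.orbit (Fin n → ℤ) q := by
          rintro ⟨w, rfl⟩
          apply hp
          simp only
          rw [lineSum_sub_smul hfree hι, lineSum_vadd hfree hι he, lineSum_vadd hfree hι hBc, hc,
            mul_assoc, hB1, mul_one, sub_self]
        rw [lineSum_sub_smul hfree hι, hB0 p hpq, mul_zero, sub_zero] at hp
        obtain ⟨q', hq', hw⟩ := h p hp
        rcases Finset.mem_insert.1 hq' with rfl | hq'
        · exact absurd hw hpq
        · exact ⟨q', hq', hw⟩
      have := A.add_mem hmem (A.zsmul_mem hBA c)
      rwa [sub_add_cancel] at this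

end Combinatorics

section Translation

/-- An integer vector which is not zero is a multiple of one whose dot product with some
integer vector is one. -/
lemma exists_primitive_of_ne_zero {n : ℕ} {v : Fin n → ℤ} (hv : v ≠ 0) :
    ∃ (g : ℤ) (v' w : Fin n → ℤ), v = g • v' ∧ v' ⬝ᵥ w = 1 := by
  obtain ⟨g, hg⟩ := (IsPrincipalIdealRing.principal (Ideal.span (Set.range v))).principal
  change Ideal.span (Set.range v) = Ideal.span {g} at hg
  have hdvd : ∀ i, g ∣ v i := fun i => by
    rw [← Ideal.mem_span_singleton, ← hg]
    exact Ideal.subset_span ⟨i, rfl⟩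
  choose v' hv' using hdvd
  have hgmem : g ∈ Ideal.span (Set.range v) := hg ▸ Ideal.mem_span_singleton_self g
  obtain ⟨w, hw⟩ := Ideal.mem_span_range_iff_exists_fun.1 hgmem
  have hg0 : g ≠ 0 := by
    rintro rfl
    exact hv (funext fun i => by simp [hv' i])
  refine ⟨g, v', w, funext fun i => by simp [hv' i], mul_left_cancel₀ hg0 ?_⟩
  rw [mul_one]
  conv_rhs => rw [← hw]
  simp only [dotProduct, Finset.mul_sum]
  refine Finset.sum_congr rfl fun i _ => ?_
  rw [hv' i]
  ring

variable {F : Type*} [Field F] {n : ℕ}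

/-- Translation of the variables of a polynomial by an integer vector. -/
noncomputable def translateHom (w : Fin n → ℤ) :
    MvPolynomial (Fin n) F →ₐ[F] MvPolynomial (Fin n) F :=
  aeval fun i => X i + C (w i : F)

lemma translateHom_X (w : Fin n → ℤ) (i : Fin n) :
    translateHom w (X i : MvPolynomial (Fin n) F) = X i + C (w i : F) := by
  simp [translateHom]

lemma translateHom_translateHom (a b : Fin n → ℤ) (P : MvPolynomial (Fin n) F) :
    translateHom a (translateHom b P) = translateHom (a + b) P := by
  rw [← AlgHom.comp_apply]
  congr 1
  ext i : 1
  simp only [AlgHom.comp_apply, translateHom_X, map_add]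
  rw [← algebraMap_eq, AlgHom.commutes]
  simp [add_assoc]

lemma translateHom_zero (P : MvPolynomial (Fin n) F) : translateHom 0 P = P := by
  simp [translateHom]

/-- Translation by an integer vector as an automorphism of the polynomial ring. -/
noncomputable def translateEquiv (w : Fin n → ℤ) :
    MvPolynomial (Fin n) F ≃ₐ[F] MvPolynomial (Fin n) F :=
  AlgEquiv.ofAlgHom (translateHom w) (translateHom (-w))
    (by ext1 i; simp only [AlgHom.comp_apply, translateHom_translateHom, add_neg_cancel,
          translateHom_zero, AlgHom.id_apply])
    (by ext1 i; simp only [AlgHom.comp_apply, translateHom_translateHom, neg_add_cancel,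
          translateHom_zero, AlgHom.id_apply])

lemma eval_translateHom (w : Fin n → ℤ) (P : MvPolynomial (Fin n) F) (x : Fin n → F) :
    eval x (translateHom w P) = eval (x + fun i => (w i : F)) P := by
  induction P using MvPolynomial.induction_on with
  | C a => rw [← algebraMap_eq, AlgHom.commutes]; simp [algebraMap_eq]
  | add p q hp hq => simp [hp, hq]
  | mul_X p i hp => simp [hp, translateHom_X]

/-- Irreducible polynomials up to associates. -/
abbrev PrimeClass (F : Type*) [Field F] (n : ℕ) : Type _ :=
  {a : Associates (MvPolynomial (Fin n) F) // Irreducible a}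

/-- The class of an irreducible polynomial. -/
noncomputable def primeClass (P : MvPolynomial (Fin n) F) (hP : Irreducible P) : PrimeClass F n :=
  ⟨Associates.mk P, Associates.irreducible_mk.2 hP⟩

lemma PrimeClass.exists_rep (p : PrimeClass F n) : ∃ P hP, p = primeClass P hP := by
  obtain ⟨a, ha⟩ := p
  obtain ⟨P, rfl⟩ := Associates.mk_surjective a
  exact ⟨P, Associates.irreducible_mk.1 ha, rfl⟩

lemma primeClass_eq_iff {P Q : MvPolynomial (Fin n) F} (hP : Irreducible P) (hQ : Irreducible Q) :
    primeClass P hP = primeClass Q hQ ↔ Associated P Q := by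
  simp [primeClass, Associates.mk_eq_mk_iff_associated]

lemma irreducible_translateHom (w : Fin n → ℤ) {P : MvPolynomial (Fin n) F} (hP : Irreducible P) :
    Irreducible (translateHom w P) :=
  (MulEquiv.irreducible_iff (translateEquiv w)).2 hP

/-- Translation on associate classes. -/
noncomputable def translateAssociates (w : Fin n → ℤ) :
    Associates (MvPolynomial (Fin n) F) → Associates (MvPolynomial (Fin n) F) :=
  Quotient.map (translateHom w) fun _ _ h => h.map (translateHom w)

lemma translateAssociates_mk (w : Fin n → ℤ) (P : MvPolynomial (Fin n) F) :
    translateAssociates w (Associates.mk P) = Associates.mk (translateHom w P) := rfl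

lemma irreducible_translateAssociates (w : Fin n → ℤ) {a : Associates (MvPolynomial (Fin n) F)}
    (ha : Irreducible a) : Irreducible (translateAssociates w a) := by
  obtain ⟨P, rfl⟩ := Associates.mk_surjective a
  rw [translateAssociates_mk, Associates.irreducible_mk]
  exact irreducible_translateHom w (Associates.irreducible_mk.1 ha)

noncomputable instance : AddAction (Fin n → ℤ) (PrimeClass F n) where
  vadd w a := ⟨translateAssociates w a.1, irreducible_translateAssociates w a.2⟩
  zero_vadd a := by
    obtain ⟨P, hP, rfl⟩ := a.exists_rep
    exact Subtype.ext (congrArg Associates.mk (translateHom_zero P))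
  add_vadd w u a := by
    obtain ⟨P, hP, rfl⟩ := a.exists_rep
    exact Subtype.ext (congrArg Associates.mk (translateHom_translateHom w u P).symm)

lemma vadd_primeClass (w : Fin n → ℤ) {P : MvPolynomial (Fin n) F} (hP : Irreducible P) :
    w +ᵥ primeClass P hP = primeClass (translateHom w P) (irreducible_translateHom w hP) := rfl

/-- The directions along which a polynomial function is constant. -/
def invariantDirections (P : MvPolynomial (Fin n) F) : Submodule F (Fin n → F) where
  carrier := {a | ∀ (t : F) (x : Fin n → F), eval (x + t • a) P = eval x P}
  add_mem' := by
    intro a b ha hb t x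
    rw [smul_add, ← add_assoc, hb, ha]
  zero_mem' := by simp
  smul_mem' := by
    intro c a ha t x
    rw [smul_smul]
    exact ha _ x

lemma eval_add_of_mem_invariantDirections {P : MvPolynomial (Fin n) F} {a : Fin n → F}
    (ha : a ∈ invariantDirections P) (x : Fin n → F) : eval (x + a) P = eval x P := by
  simpa using ha 1 x

lemma not_irreducible_of_eval_eq [Infinite F] {P : MvPolynomial (Fin n) F} {c : F}
    (h : ∀ x, eval x P = c) : ¬ Irreducible P := by
  have hPc : P = C c := MvPolynomial.funext fun x => by rw [h, eval_C]
  intro hP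
  rcases eq_or_ne c 0 with rfl | hc
  · exact hP.ne_zero (by simp [hPc])
  · exact hP.not_isUnit (hPc ▸ (IsUnit.mk0 c hc).map C)

/-- The linear form with integer coefficients `v`. -/
noncomputable def linForm (F : Type*) [Field F] (v : Fin n → ℤ) : MvPolynomial (Fin n) F :=
  ∑ i, v i • X i

lemma eval_linForm (v : Fin n → ℤ) (x : Fin n → F) :
    eval x (linForm F v) = ∑ i, (v i : F) * x i := by
  simp [linForm]

lemma translateHom_linForm [Infinite F] (v w : Fin n → ℤ) :
    translateHom w (linForm F v) = linForm F v + C (((v ⬝ᵥ w : ℤ)) : F) := by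
  apply MvPolynomial.funext
  intro x
  rw [eval_translateHom, map_add, eval_linForm, eval_linForm, eval_C]
  simp [dotProduct, mul_add, Finset.sum_add_distrib]

variable [CharZero F]

lemma Polynomial.eval_eq_of_comp_X_add_one_mul_C {q : Polynomial F} {c : F}
    (h : q.comp (Polynomial.X + 1) * Polynomial.C c = q) (t : F) : q.eval t = q.eval 0 := by
  by_cases hq : q = 0
  · simp [hq]
  have hc : c = 1 := by
    have h1 := congrArg Polynomial.leadingCoeff h
    have hdeg : (Polynomial.X + 1 : Polynomial F).natDegree ≠ 0 := by
      rw [← Polynomial.C_1, Polynomial.natDegree_X_add_C]; simp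
    rw [Polynomial.leadingCoeff_mul, Polynomial.leadingCoeff_comp hdeg, Polynomial.leadingCoeff_C,
      ← Polynomial.C_1, Polynomial.leadingCoeff_X_add_C, one_pow, mul_one] at h1
    exact mul_left_cancel₀ (Polynomial.leadingCoeff_ne_zero.2 hq) (by rw [h1, mul_one])
  subst hc
  have hper : ∀ s, q.eval (s + 1) = q.eval s := fun s => by
    simpa using congrArg (Polynomial.eval s) h
  have hnat : ∀ m : ℕ, q.eval (m : F) = q.eval 0 := by
    intro m
    induction m with
    | zero => simp
    | succ m ih => rw [Nat.cast_succ, hper, ih]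
  have hconst : q = Polynomial.C (q.eval 0) := by
    apply Polynomial.eq_of_infinite_eval_eq
    refine (Set.infinite_range_of_injective (Nat.cast_injective (R := F))).mono ?_
    rintro _ ⟨m, rfl⟩
    simp [hnat]
  rw [hconst]
  simp

lemma cast_mem_invariantDirections_of_vadd_eq {P : MvPolynomial (Fin n) F} (hP : Irreducible P)
    {w : Fin n → ℤ} (h : w +ᵥ primeClass P hP = primeClass P hP) :
    (fun i => (w i : F)) ∈ invariantDirections P := by
  rw [vadd_primeClass, primeClass_eq_iff] at h
  obtain ⟨u, hu⟩ := h
  obtain ⟨c, -, hc⟩ := MvPolynomial.isUnit_iff_eq_C_of_isReduced.1 u.isUnit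
  rw [hc] at hu
  intro t x
  let q : Polynomial F :=
    aeval (fun i => Polynomial.C (x i) + Polynomial.X * Polynomial.C (w i : F)) P
  have hq : ∀ s : F, q.eval s = eval (x + s • fun i => (w i : F)) P := by
    intro s
    have : (Polynomial.aeval s).comp
        (aeval (fun i => Polynomial.C (x i) + Polynomial.X * Polynomial.C (w i : F)))
        = aeval (R := F) (x + s • fun i => (w i : F)) := by
      ext i
      simp
    simpa [q, Polynomial.coe_aeval_eq_eval, MvPolynomial.coe_aeval_eq_eval] using
      DFunLike.congr_fun this P
  have hqc : q.comp (Polynomial.X + 1) * Polynomial.C c = q := by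
    apply Polynomial.funext
    intro s
    have := congrArg (eval (x + s • fun i => (w i : F))) hu
    rw [map_mul, eval_translateHom, eval_C] at this
    rw [Polynomial.eval_mul, Polynomial.eval_comp, Polynomial.eval_C, hq, hq, ← this]
    congr 3
    simp only [Polynomial.eval_add, Polynomial.eval_X, Polynomial.eval_one]
    module
  have := Polynomial.eval_eq_of_comp_X_add_one_mul_C hqc t
  rw [hq, hq] at this
  simpa using this

lemma vadd_eq_of_cast_mem_invariantDirections {P : MvPolynomial (Fin n) F} (hP : Irreducible P)
    {w : Fin n → ℤ} (h : (fun i => (w i : F)) ∈ invariantDirections P) :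
    w +ᵥ primeClass P hP = primeClass P hP := by
  rw [vadd_primeClass, primeClass_eq_iff]
  suffices translateHom w P = P by rw [this]
  apply MvPolynomial.funext
  intro x
  rw [eval_translateHom, eval_add_of_mem_invariantDirections h]

lemma hasSaturatedStabilizers_primeClass : HasSaturatedStabilizers n (PrimeClass F n) := by
  intro m w p hm h
  obtain ⟨P, hP, rfl⟩ := p.exists_rep
  apply vadd_eq_of_cast_mem_invariantDirections
  have h1 := (invariantDirections P).smul_mem (m : F)⁻¹
    (cast_mem_invariantDirections_of_vadd_eq hP h)
  convert h1 using 1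
  ext i
  have : (m : F) ≠ 0 := Int.cast_ne_zero.2 hm
  simp [this]

lemma exists_unitShift_vadd_ne (p : PrimeClass F n) : ∃ i : Fin n, unitShift i +ᵥ p ≠ p := by
  obtain ⟨P, hP, rfl⟩ := p.exists_rep
  by_contra! hc
  refine not_irreducible_of_eval_eq (P := P) (c := eval 0 P) (fun x => ?_) hP
  have hx : x ∈ invariantDirections P := by
    rw [pi_eq_sum_univ' x]
    refine sum_mem fun i _ => Submodule.smul_mem _ _ ?_
    convert cast_mem_invariantDirections_of_vadd_eq hP (hc i) using 1
    ext j
    simp [Pi.single_apply, eq_comm]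
  simpa using eval_add_of_mem_invariantDirections hx 0

lemma exists_isMovingDirection :
    ∃ ι : PrimeClass F n → Fin n, IsMovingDirection ι := by
  let pred : PrimeClass F n → Fin n → Prop := fun p i => unitShift i +ᵥ p ≠ p
  have hpred : ∀ (w : Fin n → ℤ) p, pred (w +ᵥ p) = pred p := by
    intro w p
    ext i
    refine not_congr ⟨fun h => ?_, fun h => ?_⟩
    · rw [vadd_comm] at h
      exact vadd_left_cancel _ h
    · rw [vadd_comm, h]
  rcases isEmpty_or_nonempty (Fin n) with hn | hn
  · have hI : IsEmpty (PrimeClass F n) :=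
      ⟨fun p => hn.elim (exists_unitShift_vadd_ne p).choose⟩
    exact ⟨fun p => hI.elim p, ⟨fun p => hI.elim p, fun _ p => hI.elim p⟩⟩
  · exact ⟨fun p => Classical.epsilon (pred p),
      ⟨fun p => Classical.epsilon_spec (exists_unitShift_vadd_ne p), fun w p => by rw [hpred]⟩⟩

/-- An irreducible polynomial with enough translational symmetry is an integer linear form plus
a constant, up to a unit. -/
lemma exists_associated_linForm [IsAlgClosed F] {P : MvPolynomial (Fin n) F} (hP : Irreducible P)
    (i : Fin n) (h : ∀ j, ∃ d a : ℤ, d ≠ 0 ∧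
      (d • unitShift j + a • unitShift i) +ᵥ primeClass P hP = primeClass P hP) :
    ∃ (v w : Fin n → ℤ) (z : F), v ⬝ᵥ w = 1 ∧ Associated P (linForm F v - C z) := by
  choose d a hd hda using h
  have hD : ∀ j, ∃ d' : ℤ, ∏ k, d k = d j * d' := fun j =>
    Finset.dvd_prod_of_mem d (Finset.mem_univ j)
  choose d' hd' using hD
  have hD0 : ((∏ k, d k : ℤ) : F) ≠ 0 :=
    Int.cast_ne_zero.2 (Finset.prod_ne_zero_iff.2 fun k _ => hd k)
  set D : ℤ := ∏ k, d k
  have hdF : ∀ j, (d j : F) ≠ 0 := fun j => Int.cast_ne_zero.2 (hd j)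
  have hdF' : ∀ j, (D : F) = d j * d' j := fun j => by rw [hd' j]; push_cast; rfl
  have hred : ∀ x : Fin n → F,
      eval x P = eval (Pi.single i ((∑ j, ((-(a j * d' j) : ℤ) : F) * x j) / D)) P := by
    intro x
    have hmem : (∑ j, (-(x j / d j)) •
        fun k => (if k = j then (d j : F) else 0) + (if k = i then (a j : F) else 0))
          ∈ invariantDirections P := by
      refine sum_mem fun j _ => Submodule.smul_mem _ _ ?_
      convert cast_mem_invariantDirections_of_vadd_eq hP (hda j) using 1
      ext k
      simp [Pi.single_apply]
    rw [← eval_add_of_mem_invariantDirections hmem]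
    congr 2
    ext k
    have hterm : ∀ j, -(x j / d j) *
        ((if k = j then (d j : F) else 0) + (if k = i then (a j : F) else 0))
        = (if k = i then ((-(a j * d' j) : ℤ) : F) * x j / D else 0)
          - (if k = j then x j else 0) := by
      intro j
      have hdj := hdF j
      have hd'j : (d' j : F) ≠ 0 := fun h0 => hD0 (by rw [hdF' j, h0, mul_zero])
      rw [hdF' j]
      push_cast
      split_ifs <;> field_simp <;> ring
    simp only [Pi.add_apply, Finset.sum_apply, Pi.smul_apply, smul_eq_mul, hterm,
      Finset.sum_sub_distrib]
    by_cases h2 : k = i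
    · subst h2
      simp [← Finset.sum_div]
    · simp [h2]
  have hv0 : (fun j => -(a j * d' j)) ≠ (0 : Fin n → ℤ) := by
    intro h0
    refine not_irreducible_of_eval_eq (P := P) (c := eval 0 P) (fun x => ?_) hP
    rw [hred x]
    have : ∀ j, -(a j * d' j) = 0 := fun j => congrFun h0 j
    simp [this]
  obtain ⟨g, v, w, hgv, hvw⟩ := exists_primitive_of_ne_zero hv0
  have hlin : ∀ x : Fin n → F, (∑ j, ((-(a j * d' j) : ℤ) : F) * x j) / D
      = (g : F) / D * eval x (linForm F v) := by
    intro x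
    rw [eval_linForm, Finset.mul_sum, Finset.sum_div]
    refine Finset.sum_congr rfl fun j _ => ?_
    have : -(a j * d' j) = g * v j := congrFun hgv j
    rw [this]
    push_cast
    ring
  let Q : Polynomial F :=
    aeval (Pi.single i (Polynomial.C ((g : F) / D) * Polynomial.X)) P
  have hQ : ∀ z : F, Q.eval z = eval (Pi.single i ((g : F) / D * z)) P := by
    intro z
    have : (Polynomial.aeval z).comp
        (aeval (Pi.single i (Polynomial.C ((g : F) / D) * Polynomial.X)))
        = aeval (R := F) (Pi.single i ((g : F) / D * z)) := by
      ext j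
      by_cases hj : j = i
      · subst hj; simp
      · simp [hj]
    simpa [Polynomial.coe_aeval_eq_eval, MvPolynomial.coe_aeval_eq_eval] using
      DFunLike.congr_fun this P
  have hPQ : P = Polynomial.aeval (linForm F v) Q := by
    apply MvPolynomial.funext
    intro x
    have : eval x (Polynomial.aeval (linForm F v) Q) = Q.eval (eval x (linForm F v)) := by
      rw [Polynomial.aeval_def, Polynomial.hom_eval₂, Polynomial.eval]
      congr 1
      ext c
      simp [algebraMap_eq]
    rw [this, hQ, hred x, hlin x]
  obtain ⟨z, hz⟩ : ∃ z, Q.IsRoot z := by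
    apply IsAlgClosed.exists_root
    intro hdeg
    rw [Polynomial.eq_C_of_degree_eq_zero hdeg, Polynomial.aeval_C] at hPQ
    exact not_irreducible_of_eval_eq (P := P) (c := Q.coeff 0)
      (fun x => by rw [hPQ, algebraMap_eq, eval_C]) hP
  obtain ⟨Q', hQ'⟩ := Polynomial.dvd_iff_isRoot.2 hz
  have hfac : P = (linForm F v - C z) * Polynomial.aeval (linForm F v) Q' := by
    conv_lhs => rw [hPQ, hQ']
    simp [algebraMap_eq]
  refine ⟨v, w, z, hvw, ?_⟩
  rcases hP.isUnit_or_isUnit hfac with hu | hu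
  · exfalso
    obtain ⟨c, -, hc⟩ := MvPolynomial.isUnit_iff_eq_C_of_isReduced.1 hu
    have h0 := congrArg (eval (0 : Fin n → F)) hc
    have h1 := congrArg (eval (fun j => (w j : F))) hc
    have hvw' : ∑ j, (v j : F) * (w j : F) = 1 := by
      have := congrArg (Int.cast : ℤ → F) hvw
      simpa [dotProduct] using this
    rw [map_sub, eval_linForm, eval_C, eval_C] at h0 h1
    rw [hvw'] at h1
    have : (0 : F) = 1 := by
      have e0 : (0 : F) - z = c := by simpa using h0
      linear_combination e0 - h1
    exact zero_ne_one this
  · rw [hfac]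
    exact (associated_mul_unit_left _ _ hu)

end Translation

section BasicCocycle

variable {n : ℕ} {I : Type*} [AddAction (Fin n → ℤ) I]

lemma vadd_notMem_orbit {p q : I} (hq : q ∉ AddAction.orbit (Fin n → ℤ) p) (u : Fin n → ℤ) :
    u +ᵥ q ∉ AddAction.orbit (Fin n → ℤ) p := by
  rintro ⟨x, hx⟩
  refine hq ⟨-u + x, ?_⟩
  simp only at hx ⊢
  rw [add_vadd, hx, neg_vadd_vadd]

/-- A cocycle supported on an orbit `{m • w +ᵥ p | m : ℤ}` on which `ℤ^n` acts through the
functional `v`, and whose `j`-th component is the signed indicator of the interval between `0`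
and `v j`. -/
structure IsIntervalCocycle (p : I) (v w : Fin n → ℤ) (B : Fin n → I →₀ ℤ) : Prop where
  vadd_eq (u : Fin n → ℤ) : u +ᵥ p = (v ⬝ᵥ u) • w +ᵥ p
  apply_zsmul (j : Fin n) (m : ℤ) :
    B j (m • w +ᵥ p) = (if 0 ≤ m then 1 else 0) - (if 0 ≤ m - v j then 1 else 0)
  apply_eq_zero (j : Fin n) (q : I) (hq : q ∉ AddAction.orbit (Fin n → ℤ) p) : B j q = 0

namespace IsIntervalCocycle

variable {p : I} {v w : Fin n → ℤ} {B : Fin n → I →₀ ℤ}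

lemma apply_vadd (h : IsIntervalCocycle p v w B) (j : Fin n) (u : Fin n → ℤ) :
    B j (u +ᵥ p) = (if 0 ≤ v ⬝ᵥ u then 1 else 0) - (if 0 ≤ v ⬝ᵥ u - v j then 1 else 0) := by
  rw [h.vadd_eq, h.apply_zsmul]

lemma isShiftCocycle (h : IsIntervalCocycle p v w B) : IsShiftCocycle B := by
  intro i j q
  by_cases hq : q ∈ AddAction.orbit (Fin n → ℤ) p
  · obtain ⟨u, rfl⟩ := hq
    simp only [vadd_vadd, h.apply_vadd, dotProduct_add, dotProduct_neg, dotProduct_single, mul_one]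
    rw [neg_add_eq_sub, neg_add_eq_sub, sub_right_comm (v ⬝ᵥ u) (v j) (v i)]
    ring
  · simp only [h.apply_eq_zero _ _ hq, h.apply_eq_zero _ _ (vadd_notMem_orbit hq _)]

lemma lineSum_eq_zero (h : IsIntervalCocycle p v w B) (ι : I → Fin n) {q : I}
    (hq : q ∉ AddAction.orbit (Fin n → ℤ) p) : lineSum ι B q = 0 := by
  simp only [lineSum, h.apply_eq_zero _ _ (vadd_notMem_orbit hq _), tsum_zero]

lemma lineSum_mul_self (h : IsIntervalCocycle p v w B) {ι : I → Fin n}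
    (hι : IsMovingDirection ι) : lineSum ι B p * lineSum ι B p = 1 := by
  have hv : v (ι p) ≠ 0 := by
    intro h0
    apply hι.single_vadd_ne p
    rw [h.vadd_eq]
    simp [h0]
  have hterm : ∀ k : ℤ, B (ι p) (k • unitShift (ι p) +ᵥ p)
      = (if 0 ≤ k * v (ι p) then 1 else 0) - (if 0 ≤ (k - 1) * v (ι p) then 1 else 0) := by
    intro k
    rw [h.apply_vadd, dotProduct_smul, dotProduct_single, mul_one, smul_eq_mul, sub_mul, one_mul]
  simp only [lineSum, hterm]
  rcases hv.lt_or_gt with hneg | hpos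
  · have hmul : ∀ k : ℤ, 0 ≤ k * v (ι p) ↔ k ≤ 0 := fun k =>
      ⟨fun hk => by by_contra! hc; nlinarith, fun hk => mul_nonneg_of_nonpos_of_nonpos hk hneg.le⟩
    simp only [hmul]
    rw [tsum_eq_single 1]
    · simp
    · intro k hk
      split_ifs <;> omega
  · simp only [mul_nonneg_iff_of_pos_right hpos]
    rw [tsum_eq_single 0]
    · simp
    · intro k hk
      split_ifs <;> omega

end IsIntervalCocycle

end BasicCocycle

section Divisors

variable {F : Type*} [Field F] {n : ℕ}

open Classical in
/-- The divisor of a nonzero polynomial. -/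
noncomputable def polyDiv (P : MvPolynomial (Fin n) F) : PrimeClass F n →₀ ℤ :=
  Finsupp.mapRange.addMonoidHom (Nat.castAddMonoidHom ℤ)
    (Multiset.toFinsupp (Associates.factors' P))

lemma polyDiv_mul {P Q : MvPolynomial (Fin n) F} (hP : P ≠ 0) (hQ : Q ≠ 0) :
    polyDiv (P * Q) = polyDiv P + polyDiv Q := by
  classical
  have : Associates.factors' (P * Q) = Associates.factors' P + Associates.factors' Q := by
    have h := Associates.factors_mul (Associates.mk P) (Associates.mk Q)
    rw [Associates.mk_mul_mk, Associates.factors_mk _ (mul_ne_zero hP hQ),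
      Associates.factors_mk _ hP, Associates.factors_mk _ hQ] at h
    exact WithTop.coe_injective h
  rw [polyDiv, this, map_add, map_add, polyDiv, polyDiv]

lemma polyDiv_irreducible {P : MvPolynomial (Fin n) F} (hP : Irreducible P) :
    polyDiv P = Finsupp.single (primeClass P hP) 1 := by
  classical
  have : Associates.factors' P = {primeClass P hP} := by
    have h := Associates.factors_self (Associates.irreducible_mk.2 hP)
    rw [Associates.factors_mk _ hP.ne_zero] at h
    exact WithTop.coe_injective h
  rw [polyDiv, this, Multiset.toFinsupp_singleton]
  simp

lemma associated_of_polyDiv_eq {P Q : MvPolynomial (Fin n) F} (hP : P ≠ 0) (hQ : Q ≠ 0)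
    (h : polyDiv P = polyDiv Q) : Associated P Q := by
  classical
  have h1 := Multiset.toFinsupp.injective
    (Finsupp.mapRange_injective _ Nat.cast_zero (Nat.cast_injective (R := ℤ)) h)
  rw [← Associates.mk_eq_mk_iff_associated]
  apply Associates.eq_of_factors_eq_factors
  rw [Associates.factors_mk _ hP, Associates.factors_mk _ hQ, h1]

lemma polyDiv_of_isUnit {P : MvPolynomial (Fin n) F} (hP : IsUnit P) : polyDiv P = 0 := by
  have h1 : polyDiv (1 : MvPolynomial (Fin n) F) = 0 := by
    have := polyDiv_mul (one_ne_zero (α := MvPolynomial (Fin n) F)) one_ne_zero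
    rw [mul_one] at this
    exact left_eq_add.1 this
  rw [← h1, polyDiv, polyDiv, Associates.factors'_cong (associated_one_iff_isUnit.2 hP)]

lemma polyDiv_translateHom (w : Fin n → ℤ) {P : MvPolynomial (Fin n) F} (hP : P ≠ 0)
    (p : PrimeClass F n) : polyDiv (translateHom w P) p = polyDiv P (-w +ᵥ p) := by
  classical
  induction P using UniqueFactorizationMonoid.induction_on_prime with
  | h₁ => exact absurd rfl hP
  | h₂ P hu => rw [polyDiv_of_isUnit hu, polyDiv_of_isUnit (hu.map _)]; rfl
  | h₃ P Q hP0 hQ ih =>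
    have hQ' := irreducible_translateHom w hQ.irreducible
    have hP0' : translateHom w P ≠ 0 :=
      (map_ne_zero_iff _ (translateEquiv w).injective).2 hP0
    rw [map_mul, polyDiv_mul hQ'.ne_zero hP0', polyDiv_mul hQ.ne_zero hP0, Finsupp.add_apply,
      Finsupp.add_apply, ih hP0, polyDiv_irreducible hQ', polyDiv_irreducible hQ.irreducible,
      ← vadd_primeClass w hQ.irreducible, Finsupp.single_apply, Finsupp.single_apply]
    simp only [eq_neg_vadd_iff]

/-- The divisor of a nonzero rational function. -/
noncomputable def rfDiv (x : RatFuncField F n) : PrimeClass F n →₀ ℤ :=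
  polyDiv (IsLocalization.sec (nonZeroDivisors (MvPolynomial (Fin n) F)) x).1
    - polyDiv (IsLocalization.sec (nonZeroDivisors (MvPolynomial (Fin n) F)) x).2.1

lemma rfDiv_div {P Q : MvPolynomial (Fin n) F} (hP : P ≠ 0) (hQ : Q ≠ 0) :
    rfDiv (algebraMap _ (RatFuncField F n) P / algebraMap _ (RatFuncField F n) Q)
      = polyDiv P - polyDiv Q := by
  set x := algebraMap _ (RatFuncField F n) P / algebraMap _ (RatFuncField F n) Q with hx
  have hspec := IsLocalization.sec_spec (nonZeroDivisors (MvPolynomial (Fin n) F)) x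
  unfold rfDiv
  set a := (IsLocalization.sec (nonZeroDivisors (MvPolynomial (Fin n) F)) x).1
  set b := (IsLocalization.sec (nonZeroDivisors (MvPolynomial (Fin n) F)) x).2
  have hb : (b : MvPolynomial (Fin n) F) ≠ 0 := nonZeroDivisors.coe_ne_zero b
  have hQ' : algebraMap _ (RatFuncField F n) Q ≠ 0 :=
    (map_ne_zero_iff _ (IsFractionRing.injective _ _)).2 hQ
  have heq : P * b = a * Q := by
    apply IsFractionRing.injective (MvPolynomial (Fin n) F) (RatFuncField F n)
    rw [map_mul, map_mul, ← hspec, hx]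
    field_simp
  have ha : a ≠ 0 := by
    intro h0
    rw [h0, zero_mul] at heq
    exact mul_ne_zero hP hb heq
  have := congrArg polyDiv heq
  rw [polyDiv_mul hP hb, polyDiv_mul ha hQ] at this
  rw [sub_eq_sub_iff_add_eq_add, ← this]

lemma exists_eq_div_of_ne_zero {x : RatFuncField F n} (hx : x ≠ 0) :
    ∃ P Q : MvPolynomial (Fin n) F, P ≠ 0 ∧ Q ≠ 0 ∧
      x = algebraMap _ (RatFuncField F n) P / algebraMap _ (RatFuncField F n) Q := by
  obtain ⟨P, Q, hQ, rfl⟩ := IsFractionRing.div_surjective (A := MvPolynomial (Fin n) F) x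
  refine ⟨P, Q, ?_, nonZeroDivisors.ne_zero hQ, rfl⟩
  rintro rfl
  simp at hx

lemma rfDiv_algebraMap {P : MvPolynomial (Fin n) F} (hP : P ≠ 0) :
    rfDiv (algebraMap _ (RatFuncField F n) P) = polyDiv P := by
  have := rfDiv_div hP (one_ne_zero (α := MvPolynomial (Fin n) F))
  rwa [map_one, div_one, polyDiv_of_isUnit isUnit_one, sub_zero] at this

lemma rfDiv_mul {x y : RatFuncField F n} (hx : x ≠ 0) (hy : y ≠ 0) :
    rfDiv (x * y) = rfDiv x + rfDiv y := by
  obtain ⟨P, Q, hP, hQ, rfl⟩ := exists_eq_div_of_ne_zero hx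
  obtain ⟨P', Q', hP', hQ', rfl⟩ := exists_eq_div_of_ne_zero hy
  rw [div_mul_div_comm, ← map_mul, ← map_mul, rfDiv_div (mul_ne_zero hP hP') (mul_ne_zero hQ hQ'),
    rfDiv_div hP hQ, rfDiv_div hP' hQ', polyDiv_mul hP hP', polyDiv_mul hQ hQ']
  abel

lemma rfDiv_one : rfDiv (1 : RatFuncField F n) = 0 := by
  have := rfDiv_mul (one_ne_zero (α := RatFuncField F n)) one_ne_zero
  rw [mul_one] at this
  exact left_eq_add.1 this

lemma rfDiv_inv {x : RatFuncField F n} (hx : x ≠ 0) : rfDiv x⁻¹ = -rfDiv x := by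
  rw [eq_neg_iff_add_eq_zero, ← rfDiv_mul (inv_ne_zero hx) hx, inv_mul_cancel₀ hx, rfDiv_one]

lemma rfDiv_div' {x y : RatFuncField F n} (hx : x ≠ 0) (hy : y ≠ 0) :
    rfDiv (x / y) = rfDiv x - rfDiv y := by
  rw [div_eq_mul_inv, rfDiv_mul hx (inv_ne_zero hy), rfDiv_inv hy, sub_eq_add_neg]

lemma rfDiv_prod {α : Type*} (s : Finset α) (g : α → RatFuncField F n) (hg : ∀ a ∈ s, g a ≠ 0) :
    rfDiv (∏ a ∈ s, g a) = ∑ a ∈ s, rfDiv (g a) := by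
  classical
  induction s using Finset.induction_on with
  | empty => simp [rfDiv_one]
  | insert a s ha ih =>
    rw [Finset.prod_insert ha, Finset.sum_insert ha,
      rfDiv_mul (hg a (Finset.mem_insert_self a s))
        (Finset.prod_ne_zero_iff.2 fun c hc => hg c (Finset.mem_insert_of_mem hc)),
      ih fun c hc => hg c (Finset.mem_insert_of_mem hc)]

lemma exists_rfDiv_eq (f : PrimeClass F n →₀ ℤ) : ∃ x : RatFuncField F n, x ≠ 0 ∧ rfDiv x = f := by
  let H : AddSubgroup (PrimeClass F n →₀ ℤ) :=
    { carrier := {f | ∃ x : RatFuncField F n, x ≠ 0 ∧ rfDiv x = f}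
      zero_mem' := ⟨1, one_ne_zero, rfDiv_one⟩
      add_mem' := by
        rintro _ _ ⟨x, hx, rfl⟩ ⟨y, hy, rfl⟩
        exact ⟨x * y, mul_ne_zero hx hy, rfDiv_mul hx hy⟩
      neg_mem' := by
        rintro _ ⟨x, hx, rfl⟩
        exact ⟨x⁻¹, inv_ne_zero hx, rfDiv_inv hx⟩ }
  change f ∈ H
  induction f using Finsupp.induction_linear with
  | zero => exact H.zero_mem
  | add f g hf hg => exact H.add_mem hf hg
  | single p m =>
    obtain ⟨P, hP, rfl⟩ := p.exists_rep
    have h1 : Finsupp.single (primeClass P hP) (1 : ℤ) ∈ H :=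
      ⟨algebraMap _ _ P, (map_ne_zero_iff _ (IsFractionRing.injective _ _)).2 hP.ne_zero, by
        rw [rfDiv_algebraMap hP.ne_zero, polyDiv_irreducible hP]⟩
    simpa using H.zsmul_mem h1 m

lemma exists_eq_algebraMap_of_rfDiv_eq_zero {x : RatFuncField F n} (hx : x ≠ 0)
    (h : rfDiv x = 0) : ∃ c : F, c ≠ 0 ∧ x = algebraMap F (RatFuncField F n) c := by
  obtain ⟨P, Q, hP, hQ, rfl⟩ := exists_eq_div_of_ne_zero hx
  rw [rfDiv_div hP hQ, sub_eq_zero] at h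
  obtain ⟨u, hu⟩ := (associated_of_polyDiv_eq hP hQ h).symm
  obtain ⟨c, hc, hcu⟩ := MvPolynomial.isUnit_iff_eq_C_of_isReduced.1 u.isUnit
  refine ⟨c, hc.ne_zero, ?_⟩
  have hQ' : algebraMap _ (RatFuncField F n) Q ≠ 0 :=
    (map_ne_zero_iff _ (IsFractionRing.injective _ _)).2 hQ
  rw [← hu, hcu, map_mul, mul_div_cancel_left₀ _ hQ', ← algebraMap_eq,
    ← IsScalarTower.algebraMap_apply]

lemma rfDiv_shift (w : Fin n → ℤ) (σ : RatFuncField F n ≃ₐ[F] RatFuncField F n)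
    (hσ : ∀ P : MvPolynomial (Fin n) F, σ (algebraMap _ (RatFuncField F n) P)
      = algebraMap _ (RatFuncField F n) (translateHom w P))
    {x : RatFuncField F n} (hx : x ≠ 0) (p : PrimeClass F n) :
    rfDiv (σ x) p = rfDiv x (-w +ᵥ p) := by
  obtain ⟨P, Q, hP, hQ, rfl⟩ := exists_eq_div_of_ne_zero hx
  have hinj : Function.Injective (translateHom (F := F) w) := (translateEquiv w).injective
  rw [map_div₀, hσ, hσ, rfDiv_div hP hQ,
    rfDiv_div ((map_ne_zero_iff _ hinj).2 hP) ((map_ne_zero_iff _ hinj).2 hQ),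
    Finsupp.sub_apply, Finsupp.sub_apply, polyDiv_translateHom w hP, polyDiv_translateHom w hQ]

end Divisors

section TwoSidedProd

variable {K : Type*} [Field K]

lemma twoSidedProd_mul (t : ℤ) (α β : ℤ → K) :
    twoSidedProd t (fun ℓ => α ℓ * β ℓ) = twoSidedProd t α * twoSidedProd t β := by
  unfold twoSidedProd
  split_ifs
  · rw [Finset.prod_mul_distrib]
  · simp only [mul_inv, Finset.prod_mul_distrib]

lemma twoSidedProd_one (t : ℤ) : twoSidedProd t (fun _ => (1 : K)) = 1 := by
  simp [twoSidedProd]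

lemma twoSidedProd_ne_zero (t : ℤ) {α : ℤ → K} (h : ∀ ℓ, α ℓ ≠ 0) : twoSidedProd t α ≠ 0 := by
  unfold twoSidedProd
  split_ifs
  · exact Finset.prod_ne_zero_iff.2 fun ℓ _ => h _
  · exact Finset.prod_ne_zero_iff.2 fun ℓ _ => inv_ne_zero (h _)

end TwoSidedProd

section Evaluation

variable {F : Type*} [Field F] {n : ℕ}

/-- The element `v·k + ℓ` of `F(k_1, …, k_n)`. -/
noncomputable def linArg (F : Type*) [Field F] {n : ℕ} (v : Fin n → ℤ) (ℓ : ℤ) :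
    RatFuncField F n :=
  (∑ i, v i • algebraMap (MvPolynomial (Fin n) F) (RatFuncField F n) (X i))
    + (ℓ : RatFuncField F n)

lemma linArg_eq (v : Fin n → ℤ) (ℓ : ℤ) :
    linArg F v ℓ = algebraMap _ (RatFuncField F n) (linForm F v + C (ℓ : F)) := by
  unfold linArg linForm
  rw [map_add, map_sum]
  congr 1
  · exact Finset.sum_congr rfl fun i _ => (map_zsmul _ _ _).symm
  · rw [map_intCast (C : F →+* MvPolynomial (Fin n) F), map_intCast]

lemma aeval_linForm_add_C_ne_zero [Infinite F] {v : Fin n → ℤ} (hv : ∃ i, (v i : F) ≠ 0) (c : F)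
    {P : Polynomial F} (hP : P ≠ 0) : Polynomial.aeval (linForm F v + C c) P ≠ 0 := by
  obtain ⟨i, hi⟩ := hv
  intro h
  apply hP
  apply Polynomial.funext
  intro y
  have h1 := congrArg (eval (Pi.single i ((y - c) / v i))) h
  rw [Polynomial.aeval_def, Polynomial.hom_eval₂] at h1
  have h2 : (eval (Pi.single i ((y - c) / (v i : F)))) (linForm F v + C c) = y := by
    rw [map_add, eval_linForm, eval_C]
    simp [Pi.single_apply]
    field_simp
    ring
  have h3 : (eval (Pi.single i ((y - c) / (v i : F)))).comp (algebraMap F _) = RingHom.id F := by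
    ext c
    simp [algebraMap_eq]
  rw [h2, h3, map_zero] at h1
  rw [Polynomial.eval_zero]
  exact h1

variable [CharZero F]

lemma eval₂_linArg_ne_zero {v : Fin n → ℤ} (hv : v ≠ 0) (ℓ : ℤ) {P : Polynomial F} (hP : P ≠ 0) :
    P.eval₂ (algebraMap F (RatFuncField F n)) (linArg F v ℓ) ≠ 0 := by
  obtain ⟨i, hi⟩ := Function.ne_iff.1 hv
  have hne := aeval_linForm_add_C_ne_zero (F := F) ⟨i, Int.cast_ne_zero.2 hi⟩ (ℓ : F) hP
  rw [linArg_eq, ← Polynomial.aeval_def, Polynomial.aeval_algebraMap_apply]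
  exact (map_ne_zero_iff _ (IsFractionRing.injective _ _)).2 hne

lemma eval_linArg_mul {v : Fin n → ℤ} (hv : v ≠ 0) (ℓ : ℤ) (r s : RatFunc F) :
    RatFunc.eval (algebraMap F (RatFuncField F n)) (linArg F v ℓ) (r * s)
      = RatFunc.eval (algebraMap F (RatFuncField F n)) (linArg F v ℓ) r
        * RatFunc.eval (algebraMap F (RatFuncField F n)) (linArg F v ℓ) s :=
  RatFunc.eval_mul _ _ (eval₂_linArg_ne_zero hv ℓ (RatFunc.denom_ne_zero r))
    (eval₂_linArg_ne_zero hv ℓ (RatFunc.denom_ne_zero s))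

lemma eval_linArg_ne_zero {v : Fin n → ℤ} (hv : v ≠ 0) (ℓ : ℤ) {r : RatFunc F} (hr : r ≠ 0) :
    RatFunc.eval (algebraMap F (RatFuncField F n)) (linArg F v ℓ) r ≠ 0 := by
  intro h
  have := eval_linArg_mul hv ℓ r r⁻¹
  rw [mul_inv_cancel₀ hr, RatFunc.eval_one, h, zero_mul] at this
  exact one_ne_zero this

/-- The product `∏_0^t r(v·k + ℓ)`. -/
noncomputable def evalProd (v : Fin n → ℤ) (r : RatFunc F) (t : ℤ) : RatFuncField F n :=
  twoSidedProd t fun ℓ => RatFunc.eval (algebraMap F (RatFuncField F n)) (linArg F v ℓ) r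

lemma evalProd_ne_zero {v : Fin n → ℤ} (hv : v ≠ 0) {r : RatFunc F} (hr : r ≠ 0) (t : ℤ) :
    evalProd v r t ≠ 0 :=
  twoSidedProd_ne_zero t fun ℓ => eval_linArg_ne_zero hv ℓ hr

lemma evalProd_mul {v : Fin n → ℤ} (hv : v ≠ 0) (r s : RatFunc F) (t : ℤ) :
    evalProd v (r * s) t = evalProd v r t * evalProd v s t := by
  simp only [evalProd, eval_linArg_mul hv, twoSidedProd_mul]

omit [CharZero F] in
lemma evalProd_one (v : Fin n → ℤ) (t : ℤ) : evalProd v (1 : RatFunc F) t = 1 := by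
  simp only [evalProd, RatFunc.eval_one, twoSidedProd_one]

/-- Quotients of monic polynomials. -/
def IsMonicQuotient (r : RatFunc F) : Prop :=
  ∃ p q : Polynomial F, p.Monic ∧ q.Monic ∧
    r = algebraMap (Polynomial F) (RatFunc F) p / algebraMap (Polynomial F) (RatFunc F) q

namespace IsMonicQuotient

omit [CharZero F]

lemma one : IsMonicQuotient (1 : RatFunc F) :=
  ⟨1, 1, Polynomial.monic_one, Polynomial.monic_one, by simp⟩

lemma mul {r s : RatFunc F} (hr : IsMonicQuotient r) (hs : IsMonicQuotient s) :
    IsMonicQuotient (r * s) := by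
  obtain ⟨p, q, hp, hq, rfl⟩ := hr
  obtain ⟨p', q', hp', hq', rfl⟩ := hs
  exact ⟨p * p', q * q', hp.mul hp', hq.mul hq', by rw [div_mul_div_comm, map_mul, map_mul]⟩

lemma inv {r : RatFunc F} (hr : IsMonicQuotient r) : IsMonicQuotient r⁻¹ := by
  obtain ⟨p, q, hp, hq, rfl⟩ := hr
  exact ⟨q, p, hq, hp, inv_div _ _⟩

lemma ne_zero {r : RatFunc F} (hr : IsMonicQuotient r) : r ≠ 0 := by
  obtain ⟨p, q, hp, hq, rfl⟩ := hr
  exact div_ne_zero (RatFunc.algebraMap_ne_zero hp.ne_zero)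
    (RatFunc.algebraMap_ne_zero hq.ne_zero)

lemma X_sub_C (z : F) :
    IsMonicQuotient (algebraMap (Polynomial F) (RatFunc F) (Polynomial.X - Polynomial.C z)) :=
  ⟨_, 1, Polynomial.monic_X_sub_C z, Polynomial.monic_one, by simp⟩

end IsMonicQuotient

end Evaluation

section OreSato

variable {F : Type*} [Field F] [CharZero F] {n : ℕ}

/-- The divisor tuples of the products appearing in the Ore–Sato theorem. -/
def IsOreSatoDiv (S : Fin n → (RatFuncField F n ≃ₐ[F] RatFuncField F n))
    (e : Fin n → PrimeClass F n →₀ ℤ) : Prop :=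
  ∃ (f : RatFuncField F n) (V : Finset (Fin n → ℤ)) (r : (Fin n → ℤ) → RatFunc F),
    f ≠ 0 ∧ 0 ∉ V ∧ (∀ v, IsMonicQuotient (r v)) ∧ (∀ v ∉ V, r v = 1) ∧
    ∀ j, e j = rfDiv (S j f) - rfDiv f + ∑ v ∈ V, rfDiv (evalProd v (r v) (v j))

/-- The group of divisor tuples of the products appearing in the Ore–Sato theorem. -/
def oreSatoDivs (S : Fin n → (RatFuncField F n ≃ₐ[F] RatFuncField F n)) :
    AddSubgroup (Fin n → PrimeClass F n →₀ ℤ) where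
  carrier := {e | IsOreSatoDiv S e}
  zero_mem' := ⟨1, ∅, fun _ => 1, one_ne_zero, by simp, fun _ => IsMonicQuotient.one,
    fun _ _ => rfl, fun j => by simp⟩
  add_mem' := by
    classical
    rintro e e' ⟨f, V, r, hf, hV, hr, hr1, he⟩ ⟨f', V', r', hf', hV', hr', hr1', he'⟩
    refine ⟨f * f', V ∪ V', r * r', mul_ne_zero hf hf', by simp [hV, hV'],
      fun v => (hr v).mul (hr' v), fun v hv => ?_, fun j => ?_⟩
    · rw [Finset.mem_union, not_or] at hv
      simp [hr1 v hv.1, hr1' v hv.2]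
    · have h1 : ∑ v ∈ V, rfDiv (evalProd v (r v) (v j))
          = ∑ v ∈ V ∪ V', rfDiv (evalProd v (r v) (v j)) :=
        Finset.sum_subset Finset.subset_union_left fun v _ hv => by
          rw [hr1 v hv, evalProd_one, rfDiv_one]
      have h2 : ∑ v ∈ V', rfDiv (evalProd v (r' v) (v j))
          = ∑ v ∈ V ∪ V', rfDiv (evalProd v (r' v) (v j)) :=
        Finset.sum_subset Finset.subset_union_right fun v _ hv => by
          rw [hr1' v hv, evalProd_one, rfDiv_one]
      have h3 : ∑ v ∈ V ∪ V', rfDiv (evalProd v ((r * r') v) (v j))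
          = ∑ v ∈ V ∪ V', rfDiv (evalProd v (r v) (v j))
            + ∑ v ∈ V ∪ V', rfDiv (evalProd v (r' v) (v j)) := by
        rw [← Finset.sum_add_distrib]
        refine Finset.sum_congr rfl fun v hv => ?_
        have hv0 : v ≠ 0 := by
          rintro rfl
          simp [hV, hV'] at hv
        rw [Pi.mul_apply, evalProd_mul hv0, rfDiv_mul (evalProd_ne_zero hv0 (hr v).ne_zero _)
          (evalProd_ne_zero hv0 (hr' v).ne_zero _)]
      rw [Pi.add_apply, he, he', h1, h2, h3, map_mul, rfDiv_mul hf hf',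
        rfDiv_mul ((map_ne_zero _).2 hf) ((map_ne_zero _).2 hf')]
      abel
  neg_mem' := by
    rintro e ⟨f, V, r, hf, hV, hr, hr1, he⟩
    refine ⟨f⁻¹, V, r⁻¹, inv_ne_zero hf, hV, fun v => (hr v).inv, fun v hv => ?_, fun j => ?_⟩
    · rw [Pi.inv_apply, hr1 v hv, inv_one]
    · have h3 : ∑ v ∈ V, rfDiv (evalProd v (r⁻¹ v) (v j))
          = -∑ v ∈ V, rfDiv (evalProd v (r v) (v j)) := by
        rw [← Finset.sum_neg_distrib]
        refine Finset.sum_congr rfl fun v hv => ?_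
        have hv0 : v ≠ 0 := by
          rintro rfl
          exact hV hv
        rw [Pi.inv_apply, eq_neg_iff_add_eq_zero,
          ← rfDiv_mul (evalProd_ne_zero hv0 (hr v).inv.ne_zero _)
            (evalProd_ne_zero hv0 (hr v).ne_zero _), ← evalProd_mul hv0,
          inv_mul_cancel₀ (hr v).ne_zero, evalProd_one, rfDiv_one]
      rw [Pi.neg_apply, he, h3, map_inv₀, rfDiv_inv hf, rfDiv_inv ((map_ne_zero _).2 hf)]
      abel

lemma sum_range_ite_add_eq (N : ℕ) (a m : ℤ) :
    ∑ ℓ ∈ Finset.range N, (if a + ℓ = m then (1 : ℤ) else 0)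
      = (if 0 ≤ m - a then 1 else 0) - (if 0 ≤ m - a - N then 1 else 0) := by
  induction N with
  | zero => simp
  | succ N ih =>
    rw [Finset.sum_range_succ, ih]
    push_cast
    split_ifs <;> omega

lemma rfDiv_evalProd_X_sub_C {v w : Fin n → ℤ} {z : F} (hvw : v ⬝ᵥ w = 1)
    (hL : Irreducible (linForm F v - C z)) (t : ℤ) :
    rfDiv (evalProd v (algebraMap (Polynomial F) (RatFunc F) (Polynomial.X - Polynomial.C z)) t)
      = if 0 ≤ t then
          ∑ ℓ ∈ Finset.range t.toNat, Finsupp.single ((ℓ : ℤ) • w +ᵥ primeClass _ hL) (1 : ℤ)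
        else -∑ ℓ ∈ Finset.range (-t).toNat,
          Finsupp.single ((t + (ℓ : ℤ)) • w +ᵥ primeClass _ hL) (1 : ℤ) := by
  have hv0 : v ≠ 0 := by
    rintro rfl
    simp at hvw
  have hr := (IsMonicQuotient.X_sub_C z).ne_zero
  have hval : ∀ ℓ : ℤ, rfDiv (RatFunc.eval (algebraMap F (RatFuncField F n)) (linArg F v ℓ)
      (algebraMap (Polynomial F) (RatFunc F) (Polynomial.X - Polynomial.C z)))
      = Finsupp.single (ℓ • w +ᵥ primeClass _ hL) 1 := by
    intro ℓ
    have htr : translateHom (ℓ • w) (linForm F v - C z) = linForm F v + C (ℓ : F) - C z := by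
      rw [map_sub, translateHom_linForm, dotProduct_smul, hvw, ← algebraMap_eq, AlgHom.commutes]
      simp
    have hirr := irreducible_translateHom (ℓ • w) hL
    rw [vadd_primeClass, ← polyDiv_irreducible hirr, ← rfDiv_algebraMap hirr.ne_zero, htr,
      RatFunc.eval_algebraMap]
    congr 1
    simp only [Algebra.algebraMap_self, RingHom.id_apply, Polynomial.eval₂_sub,
      Polynomial.eval₂_X, Polynomial.eval₂_C]
    rw [linArg_eq, map_sub, ← algebraMap_eq, ← IsScalarTower.algebraMap_apply]
  unfold evalProd twoSidedProd
  split_ifs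
  · rw [rfDiv_prod _ _ fun ℓ _ => eval_linArg_ne_zero hv0 _ hr]
    exact Finset.sum_congr rfl fun ℓ _ => hval _
  · rw [rfDiv_prod _ _ fun ℓ _ => inv_ne_zero (eval_linArg_ne_zero hv0 _ hr),
      ← Finset.sum_neg_distrib]
    refine Finset.sum_congr rfl fun ℓ _ => ?_
    rw [rfDiv_inv (eval_linArg_ne_zero hv0 _ hr), hval]

lemma isIntervalCocycle_linForm {v w : Fin n → ℤ} {z : F} (hvw : v ⬝ᵥ w = 1)
    (hL : Irreducible (linForm F v - C z)) :
    IsIntervalCocycle (primeClass _ hL) v w fun j => rfDiv (evalProd v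
      (algebraMap (Polynomial F) (RatFunc F) (Polynomial.X - Polynomial.C z)) (v j)) := by
  classical
  have hvw' : ∑ j, (v j : F) * (w j : F) = 1 := by
    have := congrArg (Int.cast : ℤ → F) hvw
    simpa [dotProduct] using this
  have hw : w +ᵥ primeClass _ hL ≠ primeClass _ hL := by
    intro h
    have h1 := eval_add_of_mem_invariantDirections
      (cast_mem_invariantDirections_of_vadd_eq hL h) 0
    rw [map_sub, map_sub, eval_linForm, eval_linForm] at h1
    simp [hvw'] at h1
  have hinj := zsmul_vadd_injective hasSaturatedStabilizers_primeClass hw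
  have hval : ∀ a m : ℤ, (Finsupp.single (a • w +ᵥ primeClass _ hL) (1 : ℤ))
      (m • w +ᵥ primeClass _ hL) = if a = m then 1 else 0 := by
    intro a m
    rw [Finsupp.single_apply]
    exact if_congr hinj.eq_iff rfl rfl
  refine ⟨fun u => ?_, fun j m => ?_, fun j q hq => ?_⟩
  · rw [vadd_primeClass, vadd_primeClass]
    congr 1
    rw [map_sub, map_sub, translateHom_linForm, translateHom_linForm, dotProduct_smul, hvw,
      smul_eq_mul, mul_one, ← algebraMap_eq, AlgHom.commutes, AlgHom.commutes]
  · rw [rfDiv_evalProd_X_sub_C hvw hL]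
    by_cases h0 : 0 ≤ v j
    · have := sum_range_ite_add_eq (v j).toNat 0 m
      rw [if_pos h0]
      simp only [Finsupp.finsetSum_apply, hval]
      simpa only [zero_add, sub_zero, Int.toNat_of_nonneg h0] using this
    · have := sum_range_ite_add_eq (-v j).toNat (v j) m
      rw [Int.toNat_of_nonneg (by omega), sub_neg_eq_add, sub_add_cancel] at this
      rw [if_neg h0]
      simp only [Finsupp.neg_apply, Finsupp.finsetSum_apply, hval]
      rw [this, neg_sub]
  · have hne : ∀ a : ℤ, (Finsupp.single (a • w +ᵥ primeClass _ hL) (1 : ℤ)) q = 0 := by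
      intro a
      rw [Finsupp.single_apply, if_neg]
      rintro rfl
      exact hq ⟨_, rfl⟩
    rw [rfDiv_evalProd_X_sub_C hvw hL]
    split_ifs <;> simp only [Finsupp.neg_apply, Finsupp.finsetSum_apply, hne,
      Finset.sum_const_zero, neg_zero]

/-- Every cocycle of divisors comes from a product as in the Ore–Sato theorem. -/
lemma mem_oreSatoDivs_of_isShiftCocycle [IsAlgClosed F]
    (S : Fin n → (RatFuncField F n ≃ₐ[F] RatFuncField F n))
    (hS : ∀ j (P : MvPolynomial (Fin n) F), S j (algebraMap _ (RatFuncField F n) P)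
      = algebraMap _ (RatFuncField F n) (translateHom (unitShift j) P))
    {e : Fin n → PrimeClass F n →₀ ℤ} (he : IsShiftCocycle e) : IsOreSatoDiv S e := by
  classical
  obtain ⟨ι, hι⟩ := exists_isMovingDirection (F := F) (n := n)
  refine mem_of_isShiftCocycle hasSaturatedStabilizers_primeClass hι (oreSatoDivs S) ?_ ?_ he
  · intro f e hfe
    obtain ⟨x, hx, rfl⟩ := exists_rfDiv_eq f
    refine ⟨x, ∅, fun _ => 1, hx, by simp, fun _ => IsMonicQuotient.one, fun _ _ => rfl,
      fun j => ?_⟩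
    ext p
    simp only [Finset.sum_empty, add_zero, Finsupp.sub_apply]
    rw [rfDiv_shift _ _ (hS j) hx, hfe]
  · intro p hp
    obtain ⟨P, hP, rfl⟩ := p.exists_rep
    obtain ⟨v, w, z, hvw, hass⟩ := exists_associated_linForm hP _ hp
    have hL := hass.irreducible hP
    have hPL : primeClass P hP = primeClass _ hL := (primeClass_eq_iff hP hL).2 hass
    have hB := isIntervalCocycle_linForm hvw hL
    rw [hPL]
    refine ⟨_, ?_, hB.isShiftCocycle, hB.lineSum_mul_self hι, fun q hq => hB.lineSum_eq_zero ι hq⟩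
    have hv0 : v ≠ 0 := by
      rintro rfl
      simp at hvw
    refine ⟨1, {v}, fun u => if u = v then
      algebraMap (Polynomial F) (RatFunc F) (Polynomial.X - Polynomial.C z) else 1,
      one_ne_zero, by simpa using hv0.symm, fun u => ?_, fun u hu => ?_, fun j => ?_⟩
    · dsimp only
      split_ifs
      · exact IsMonicQuotient.X_sub_C z
      · exact IsMonicQuotient.one
    · exact if_neg (by simpa using hu)
    · simp

end OreSato

/-- **The Ore–Sato theorem.**
`F` is an algebraically closed field of characteristic zero and, for each `j`, `S j` is
the `F`-algebra automorphism of `F(k_1, …, k_n)` sending `k_j ↦ k_j + 1` and fixing the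
other variables.  If nonzero `b_1, …, b_n ∈ F(k_1, …, k_n)` satisfy
`b_i · S_i(b_j) = b_j · S_j(b_i)` for `i < j`, then there are a nonzero
`f ∈ F(k_1, …, k_n)`, nonzero constants `μ_j ∈ F`, a finite set `V ⊂ ℤ^n \ {0}` and for
each `v ∈ V` a univariate rational function `r_v ∈ F(z)` which is a quotient of monic
polynomials, such that
`b_j = (S_j(f)/f) · μ_j · ∏_{v ∈ V} ∏_0^{v_j} r_v(v·k + ℓ)` for all `j`. -/
theorem ore_sato
    (F : Type*) [Field F] [IsAlgClosed F] [CharZero F] (n : ℕ)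
    (S : Fin n → (RatFuncField F n ≃ₐ[F] RatFuncField F n))
    (hS : ∀ j i : Fin n,
      S j (algebraMap (MvPolynomial (Fin n) F) (RatFuncField F n) (X i))
        = algebraMap (MvPolynomial (Fin n) F) (RatFuncField F n) (X i)
          + (if i = j then 1 else 0))
    (b : Fin n → RatFuncField F n) (hb : ∀ j, b j ≠ 0)
    (hcompat : ∀ i j : Fin n, i < j → b i * S i (b j) = b j * S j (b i)) :
    ∃ (f : RatFuncField F n) (_ : f ≠ 0) (μ : Fin n → F) (_ : ∀ j, μ j ≠ 0)
      (V : Finset (Fin n → ℤ)) (_ : (0 : Fin n → ℤ) ∉ V)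
      (r : (Fin n → ℤ) → RatFunc F),
      (∀ v ∈ V, ∃ p q : Polynomial F, p.Monic ∧ q.Monic ∧
        r v = algebraMap (Polynomial F) (RatFunc F) p /
              algebraMap (Polynomial F) (RatFunc F) q) ∧
      ∀ j, b j = S j f / f * algebraMap F (RatFuncField F n) (μ j) *
        ∏ v ∈ V, twoSidedProd (v j) (fun ℓ =>
          RatFunc.eval (algebraMap F (RatFuncField F n))
            ((∑ i, v i • algebraMap (MvPolynomial (Fin n) F) (RatFuncField F n) (X i))
              + (ℓ : RatFuncField F n))
            (r v)) := by
  have hS' : ∀ j (P : MvPolynomial (Fin n) F), S j (algebraMap _ (RatFuncField F n) P)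
      = algebraMap _ (RatFuncField F n) (translateHom (unitShift j) P) := by
    intro j P
    have : ((S j).toAlgHom.comp (IsScalarTower.toAlgHom F (MvPolynomial (Fin n) F)
        (RatFuncField F n))) = (IsScalarTower.toAlgHom F (MvPolynomial (Fin n) F)
        (RatFuncField F n)).comp (translateHom (unitShift j)) := by
      ext i
      simp only [AlgHom.comp_apply, IsScalarTower.coe_toAlgHom', translateHom_X]
      change S j _ = _
      rw [hS, map_add]
      by_cases hij : i = j <;> simp [hij]
    exact DFunLike.congr_fun this P
  have hSb : ∀ i j, S i (b j) ≠ 0 := fun i j => (map_ne_zero _).2 (hb j)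
  have hcoc : IsShiftCocycle fun j => rfDiv (b j) := by
    have hlt : ∀ i j, i < j → ∀ p, rfDiv (b i) p + rfDiv (b j) (-unitShift i +ᵥ p)
        = rfDiv (b j) p + rfDiv (b i) (-unitShift j +ᵥ p) := by
      intro i j hij p
      have := DFunLike.congr_fun (congrArg rfDiv (hcompat i j hij)) p
      rwa [rfDiv_mul (hb i) (hSb i j), rfDiv_mul (hb j) (hSb j i), Finsupp.add_apply,
        Finsupp.add_apply, rfDiv_shift _ _ (hS' i) (hb j), rfDiv_shift _ _ (hS' j) (hb i)] at this
    intro i j p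
    rcases lt_trichotomy i j with h | rfl | h
    · exact hlt i j h p
    · rfl
    · exact (hlt j i h p).symm
  obtain ⟨f, V, r, hf, hV, hr, -, he⟩ := mem_oreSatoDivs_of_isShiftCocycle S hS' hcoc
  have hprod0 : ∀ j, ∀ v ∈ V, evalProd v (r v) (v j) ≠ 0 := fun j v hv =>
    evalProd_ne_zero (fun h0 => hV (h0 ▸ hv)) (hr v).ne_zero _
  have hP0 : ∀ j, ∏ v ∈ V, evalProd v (r v) (v j) ≠ 0 := fun j =>
    Finset.prod_ne_zero_iff.2 (hprod0 j)
  have hSf : ∀ j, S j f ≠ 0 := fun j => (map_ne_zero _).2 hf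
  have hc0 : ∀ j, S j f / f * ∏ v ∈ V, evalProd v (r v) (v j) ≠ 0 := fun j =>
    mul_ne_zero (div_ne_zero (hSf j) hf) (hP0 j)
  have hμ : ∀ j, ∃ c : F, c ≠ 0 ∧ b j / (S j f / f * ∏ v ∈ V, evalProd v (r v) (v j))
      = algebraMap F (RatFuncField F n) c := fun j => by
    refine exists_eq_algebraMap_of_rfDiv_eq_zero (div_ne_zero (hb j) (hc0 j)) ?_
    rw [rfDiv_div' (hb j) (hc0 j), rfDiv_mul (div_ne_zero (hSf j) hf) (hP0 j),
      rfDiv_div' (hSf j) hf, rfDiv_prod _ _ (hprod0 j), sub_eq_zero]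
    exact he j
  choose μ hμ0 hμ using hμ
  refine ⟨f, hf, μ, hμ0, V, hV, r, fun v _ => hr v, fun j => ?_⟩
  change b j = S j f / f * algebraMap F (RatFuncField F n) (μ j) *
    ∏ v ∈ V, evalProd v (r v) (v j)
  rw [← hμ j, mul_right_comm, mul_div_cancel₀ _ (hc0 j)]
end
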